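/- arXiv:2201.10158 — 4 statements merged into one kernel-verified Lean document; each statement's English description precedes it below -/
import Mathlib

section
/- Let d ≥ 1, α ∈ (0,2), r > −α and p ∈ ((−r) ∨ 0, α). Suppose b : ℝ^d → ℝ^d and σ : ℝ^d → ℝ^{d×d} are locally bounded measurable functions and there exist constants c₀, c₁ > 0 such that for all x ∈ ℝ^d with |x| > 1 one has q ‖σ(x)‖^α |x|^{2−α} + ⟨x, b(x)⟩ ≤ −c₀ |x|^{2+r} + c₁. Then there exist constants κ₀, κ₁ > 0 such that for all x ∈ ℝ^d: 𝓛_σ V_p(x) + ⟨b(x), ∇V_p(x)⟩ ≤ −κ₀ V_p(x)^{1+r/p} + κ₁. -/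
open MeasureTheory Real
open scoped RealInnerProductSpace

lemma aux_concave {e t u : ℝ} (he : 0 ≤ e) (he1 : e ≤ 1) (ht : 0 < t) (hu : 0 ≤ u) :
    u ^ e ≤ t ^ e + e * t ^ (e - 1) * (u - t) := by
  have h := rpow_one_add_le_one_add_mul_self (s := u / t - 1) (by have : 0 ≤ u / t := by positivity
                                                                  linarith) he he1
  have h1 : 1 + (u / t - 1) = u / t := by ring
  rw [h1, Real.div_rpow hu ht.le, div_le_iff₀ (by positivity)] at h
  rw [Real.rpow_sub_one ht.ne']
  refine h.trans (le_of_eq ?_)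
  field_simp

lemma aux_diff {E : Type*} [NormedAddCommGroup E] [InnerProductSpace ℝ E] (x h : E) {p : ℝ}
    (hp : 0 < p) (hp2 : p < 2) :
    (1 + ‖x + h‖ ^ 2) ^ (p / 2) + (1 + ‖x - h‖ ^ 2) ^ (p / 2) - 2 * (1 + ‖x‖ ^ 2) ^ (p / 2)
      ≤ p * (1 + ‖x‖ ^ 2) ^ (p / 2 - 1) * ‖h‖ ^ 2 ∧
    (1 + ‖x + h‖ ^ 2) ^ (p / 2) + (1 + ‖x - h‖ ^ 2) ^ (p / 2) - 2 * (1 + ‖x‖ ^ 2) ^ (p / 2)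
      ≤ 2 * ‖h‖ ^ p := by
  have hpar := parallelogram_law_with_norm ℝ x h
  have he : 0 ≤ p / 2 := by linarith
  have he1 : p / 2 ≤ 1 := by linarith
  have hu : 0 ≤ 1 + ‖x + h‖ ^ 2 := by positivity
  have hv : 0 ≤ 1 + ‖x - h‖ ^ 2 := by positivity
  constructor
  · have ht : 0 < 1 + ‖x‖ ^ 2 := by positivity
    have h1 := aux_concave he he1 ht hu
    have h2 := aux_concave he he1 ht hv
    have : ‖x - h‖ ^ 2 = 2 * (‖x‖ ^ 2 + ‖h‖ ^ 2) - ‖x + h‖ ^ 2 := by linarith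
    rw [this] at h2 ⊢
    linarith
  · have ht : 0 < 1 + ‖x‖ ^ 2 + ‖h‖ ^ 2 := by positivity
    have h1 := aux_concave he he1 ht hu
    have h2 := aux_concave he he1 ht hv
    have : ‖x - h‖ ^ 2 = 2 * (‖x‖ ^ 2 + ‖h‖ ^ 2) - ‖x + h‖ ^ 2 := by linarith
    rw [this] at h2 ⊢
    have h3 := Real.rpow_add_le_add_rpow (show 0 ≤ 1 + ‖x‖ ^ 2 by positivity)
      (show 0 ≤ ‖h‖ ^ 2 by positivity) he he1
    have h4 : (‖h‖ ^ 2) ^ (p / 2) = ‖h‖ ^ p := by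
      rw [← Real.rpow_natCast, ← Real.rpow_mul (norm_nonneg _)]
      congr 1
      push_cast
      ring
    rw [h4] at h3
    linarith

lemma aux_radial (d : ℕ) (hd : 1 ≤ d) {α p R A B : ℝ} (hα2 : α < 2) (hpα : p < α)
    (hR : 0 < R) :
    Integrable (fun z : EuclideanSpace ℝ (Fin d) =>
      (if ‖z‖ ≤ R then A * ‖z‖ ^ 2 else B * ‖z‖ ^ p) * ‖z‖ ^ (-(d : ℝ) - α)) ∧
    ∫ z : EuclideanSpace ℝ (Fin d),
      (if ‖z‖ ≤ R then A * ‖z‖ ^ 2 else B * ‖z‖ ^ p) * ‖z‖ ^ (-(d : ℝ) - α)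
      = 2 * π ^ ((d : ℝ) / 2) / Gamma ((d : ℝ) / 2) *
        (A * (R ^ (2 - α) / (2 - α)) + B * (R ^ (p - α) / (α - p))) := by
  have : NeZero d := ⟨by omega⟩
  have : Nonempty (Fin d) := ⟨0⟩
  have : Nontrivial (EuclideanSpace ℝ (Fin d)) := by
    refine Module.nontrivial_of_finrank_pos (R := ℝ) ?_
    simp; omega
  let G : ℝ → ℝ := fun y => (if y ≤ R then A * y ^ 2 else B * y ^ p) * y ^ (-(d : ℝ) - α)
  have hd1 : ∀ y : ℝ, 0 < y → y ^ (d - 1) = y ^ ((d : ℝ) - 1) := by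
    intro y hy
    rw [← Real.rpow_natCast, Nat.cast_sub hd]; simp
  have e1 : Set.EqOn (fun y : ℝ => y ^ (d - 1) • G y) (fun y => A * y ^ (1 - α)) (Set.Ioc 0 R) := by
    intro y hy
    simp only [G, hy.2, if_true, smul_eq_mul]
    rw [hd1 y hy.1, ← Real.rpow_natCast y 2]
    have : y ^ (1 - α) = y ^ ((d : ℝ) - 1) * y ^ ((2 : ℕ) : ℝ) * y ^ (-(d : ℝ) - α) := by
      rw [← Real.rpow_add hy.1, ← Real.rpow_add hy.1]; congr 1; push_cast; ring
    rw [this]; ring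
  have e2 : Set.EqOn (fun y : ℝ => y ^ (d - 1) • G y) (fun y => B * y ^ (p - 1 - α))
      (Set.Ioi R) := by
    intro y hy
    have hy0 : 0 < y := hR.trans hy
    simp only [G, not_le.2 (Set.mem_Ioi.1 hy), if_false, smul_eq_mul]
    rw [hd1 y hy0]
    have : y ^ (p - 1 - α) = y ^ ((d : ℝ) - 1) * y ^ p * y ^ (-(d : ℝ) - α) := by
      rw [← Real.rpow_add hy0, ← Real.rpow_add hy0]; congr 1; ring
    rw [this]; ring
  have i1 : IntegrableOn (fun y : ℝ => y ^ (d - 1) • G y) (Set.Ioc 0 R) := by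
    rw [integrableOn_congr_fun e1 measurableSet_Ioc]
    refine Integrable.const_mul ?_ A
    exact (intervalIntegrable_iff_integrableOn_Ioc_of_le hR.le).1
      (intervalIntegral.intervalIntegrable_rpow' (by linarith))
  have i2 : IntegrableOn (fun y : ℝ => y ^ (d - 1) • G y) (Set.Ioi R) := by
    rw [integrableOn_congr_fun e2 measurableSet_Ioi]
    refine Integrable.const_mul ?_ B
    exact integrableOn_Ioi_rpow_of_lt (by linarith) hR
  have i3 : IntegrableOn (fun y : ℝ => y ^ (d - 1) • G y) (Set.Ioi 0) := by
    rw [← Set.Ioc_union_Ioi_eq_Ioi hR.le]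
    exact i1.union i2
  have v3 : ∫ y in Set.Ioi (0 : ℝ), y ^ (d - 1) • G y
      = A * (R ^ (2 - α) / (2 - α)) + B * (R ^ (p - α) / (α - p)) := by
    rw [← Set.Ioc_union_Ioi_eq_Ioi hR.le,
      setIntegral_union (Set.Ioc_disjoint_Ioi le_rfl) measurableSet_Ioi i1 i2,
      setIntegral_congr_fun measurableSet_Ioc e1, setIntegral_congr_fun measurableSet_Ioi e2,
      integral_const_mul, integral_const_mul, ← intervalIntegral.integral_of_le hR.le,
      integral_rpow (Or.inl (by linarith)), integral_Ioi_rpow_of_lt (by linarith) hR]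
    have a1 : 1 - α + 1 = 2 - α := by ring
    have a2 : p - 1 - α + 1 = p - α := by ring
    rw [a1, a2, Real.zero_rpow (by linarith), sub_zero, ← neg_sub α p, neg_div_neg_eq]
  have hfr : Module.finrank ℝ (EuclideanSpace ℝ (Fin d)) = d := by simp
  constructor
  · have := (integrable_fun_norm_addHaar (volume : Measure (EuclideanSpace ℝ (Fin d)))
      (f := G)).2 (by rw [hfr]; exact i3)
    exact this
  · have := integral_fun_norm_addHaar (volume : Measure (EuclideanSpace ℝ (Fin d))) G
    rw [hfr, v3] at this
    refine this.trans ?_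
    have hdp : (0 : ℝ) < d := by exact_mod_cast hd
    have hG : 0 < Gamma ((d : ℝ) / 2) := Real.Gamma_pos_of_pos (by positivity)
    have hv : (volume : Measure (EuclideanSpace ℝ (Fin d))).real (Metric.ball 0 1)
        = π ^ ((d : ℝ) / 2) / Gamma ((d : ℝ) / 2 + 1) := by
      rw [measureReal_def, EuclideanSpace.volume_ball]
      have hG1 : 0 < Gamma ((d : ℝ) / 2 + 1) := Real.Gamma_pos_of_pos (by positivity)
      simp only [ENNReal.ofReal_one, one_pow, one_mul, Fintype.card_fin]
      rw [ENNReal.toReal_ofReal (by positivity), Real.sqrt_eq_rpow, ← Real.rpow_natCast,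
        ← Real.rpow_mul Real.pi_pos.le]
      congr 2; ring
    rw [hv, Real.Gamma_add_one (by positivity), nsmul_eq_mul, smul_eq_mul, ← mul_assoc]
    congr 1
    field_simp

lemma aux_int (d : ℕ) (hd : 1 ≤ d) {α p R : ℝ} (hα2 : α < 2) (hp : 0 < p) (hpα : p < α)
    (hR : 0 < R) (T : EuclideanSpace ℝ (Fin d) →L[ℝ] EuclideanSpace ℝ (Fin d))
    (x : EuclideanSpace ℝ (Fin d)) :
    ∫ z : EuclideanSpace ℝ (Fin d),
            ((1 + ‖x + T z‖ ^ 2) ^ (p / 2) + (1 + ‖x - T z‖ ^ 2) ^ (p / 2)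
              - 2 * (1 + ‖x‖ ^ 2) ^ (p / 2)) * ‖z‖ ^ (-(d : ℝ) - α)
      ≤ 2 * π ^ ((d : ℝ) / 2) / Gamma ((d : ℝ) / 2) *
        ((p * (1 + ‖x‖ ^ 2) ^ (p / 2 - 1) * ‖T‖ ^ 2) * (R ^ (2 - α) / (2 - α))
          + (2 * ‖T‖ ^ p) * (R ^ (p - α) / (α - p))) := by
  obtain ⟨hi, hv⟩ := aux_radial d hd (A := p * (1 + ‖x‖ ^ 2) ^ (p / 2 - 1) * ‖T‖ ^ 2)
    (B := 2 * ‖T‖ ^ p) hα2 hpα hR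
  rw [← hv]
  by_cases hf : Integrable (fun z : EuclideanSpace ℝ (Fin d) =>
            ((1 + ‖x + T z‖ ^ 2) ^ (p / 2) + (1 + ‖x - T z‖ ^ 2) ^ (p / 2)
              - 2 * (1 + ‖x‖ ^ 2) ^ (p / 2)) * ‖z‖ ^ (-(d : ℝ) - α))
  · refine integral_mono hf hi fun z => ?_
    obtain ⟨h1, h2⟩ := aux_diff x (T z) hp (hpα.trans hα2)
    have hT := T.le_opNorm z
    refine mul_le_mul_of_nonneg_right ?_ (by positivity)
    split_ifs
    · refine h1.trans ?_
      rw [mul_assoc _ (‖T‖ ^ 2), ← mul_pow]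
      gcongr
    · refine h2.trans ?_
      rw [mul_assoc, ← Real.mul_rpow (by positivity) (by positivity)]
      gcongr
  · rw [integral_undef hf]
    refine integral_nonneg fun z => ?_
    refine mul_nonneg ?_ (by positivity)
    split_ifs <;> positivity

lemma aux_grad {E : Type*} [NormedAddCommGroup E] [InnerProductSpace ℝ E] [CompleteSpace E]
    (x v : E) (p : ℝ) :
    ⟪v, gradient (fun y : E => (1 + ‖y‖ ^ 2) ^ (p / 2)) x⟫
      = p * (1 + ‖x‖ ^ 2) ^ (p / 2 - 1) * ⟪x, v⟫ := by
  have h : HasFDerivAt (fun y : E => (1 + ‖y‖ ^ 2) ^ (p / 2))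
      ((p / 2 * (1 + ‖x‖ ^ 2) ^ (p / 2 - 1)) • (2 • (innerSL ℝ x))) x :=
    (((hasStrictFDerivAt_norm_sq x).hasFDerivAt).const_add 1).rpow_const
      (Or.inl (by positivity))
  rw [inner_gradient_right, h.fderiv]
  simp
  ring

lemma aux_scal {α p S X : ℝ} (hα : 0 < α) (hα2 : α < 2) (hp : 0 < p) (hpα : p < α)
    (hS : 0 < S) (hX : 1 < X) :
    (p * (1 + X ^ 2) ^ (p / 2 - 1) * S ^ 2) * ((X / S) ^ (2 - α) / (2 - α))
          + (2 * S ^ p) * ((X / S) ^ (p - α) / (α - p))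
      ≤ p * (1 + X ^ 2) ^ (p / 2 - 1) *
        (2 ^ (3 + α) * (1 / (2 - α) + 1 / ((α - p) * p)) * S ^ α * X ^ (2 - α)) := by
  have hX0 : 0 < X := by linarith
  have h2α : 0 < 2 - α := by linarith
  have hαp : 0 < α - p := by linarith
  set w := (1 + X ^ 2) ^ (p / 2 - 1) with hw
  have hw0 : 0 < w := by positivity
  have hXw : X ^ (p - 2) ≤ 2 * w := by
    have h1 : (2 * X ^ 2) ^ (p / 2 - 1) ≤ w :=
      Real.rpow_le_rpow_of_nonpos (by positivity) (by nlinarith) (by linarith)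
    have h2 : (2 * X ^ 2) ^ (p / 2 - 1) = 2 ^ (p / 2 - 1) * X ^ (p - 2) := by
      rw [Real.mul_rpow (by norm_num) (by positivity), ← Real.rpow_natCast,
        ← Real.rpow_mul hX0.le]
      congr 2
      push_cast
      ring
    have h3 : (2 : ℝ) ^ (-1 : ℝ) ≤ 2 ^ (p / 2 - 1) :=
      Real.rpow_le_rpow_of_exponent_le (by norm_num) (by linarith)
    rw [Real.rpow_neg_one] at h3
    have h4 : 0 < X ^ (p - 2) := by positivity
    have h5 := mul_le_mul_of_nonneg_right h3 h4.le
    rw [h2] at h1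
    linarith
  have h8 : (8 : ℝ) ≤ 2 ^ (3 + α) := by
    have : (2 : ℝ) ^ (3 : ℝ) ≤ 2 ^ (3 + α) :=
      Real.rpow_le_rpow_of_exponent_le (by norm_num) (by linarith)
    have h : (2 : ℝ) ^ (3 : ℝ) = 8 := by norm_num
    linarith
  set U := S ^ α * X ^ (2 - α) with hU
  have hU0 : 0 < U := by positivity
  have e1 : S ^ 2 * (X / S) ^ (2 - α) = U := by
    rw [Real.div_rpow hX0.le hS.le, hU]
    have : S ^ 2 = S ^ α * S ^ (2 - α) := by
      rw [← Real.rpow_add hS, ← Real.rpow_natCast]; congr 1; push_cast; ring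
    rw [this]
    have : 0 < S ^ (2 - α) := by positivity
    field_simp
  have e2 : S ^ p * (X / S) ^ (p - α) = U * X ^ (p - 2) := by
    rw [Real.div_rpow hX0.le hS.le, hU]
    have h1 : S ^ p = S ^ α * S ^ (p - α) := by
      rw [← Real.rpow_add hS]; congr 1; ring
    have h2 : X ^ (p - α) = X ^ (2 - α) * X ^ (p - 2) := by
      rw [← Real.rpow_add hX0]; congr 1; ring
    rw [h1, h2]
    have : 0 < S ^ (p - α) := by positivity
    field_simp
  calc _ = p * w * (S ^ 2 * (X / S) ^ (2 - α)) / (2 - α)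
        + 2 * (S ^ p * (X / S) ^ (p - α)) / (α - p) := by ring
    _ = 1 * (p * w * U / (2 - α)) + 2 * (U * X ^ (p - 2)) / (α - p) := by rw [e1, e2, one_mul]
    _ ≤ 2 ^ (3 + α) * (p * w * U / (2 - α)) + 2 ^ (3 + α) * (w * U) / (α - p) := by
      gcongr ?_ * _ + ?_ / _
      · linarith
      · have := mul_le_mul_of_nonneg_left hXw hU0.le
        have := mul_le_mul_of_nonneg_right h8 (mul_pos hw0 hU0).le
        nlinarith [mul_pos hw0 hU0]
    _ = _ := by
      rw [hU]
      field_simp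

set_option maxHeartbeats 1000000 in
/-- **Lemma 3.1 of the paper.** Let `α ∈ (0,2)`, `r > -α`,
`p ∈ ((-r) ∨ 0, α)`, and let `b, σ` be locally bounded measurable coefficients
satisfying the dissipativity condition
`q‖σ(x)‖^α |x|^{2-α} + ⟨x, b(x)⟩ ≤ -c₀|x|^{2+r} + c₁` for `|x| > 1`,
with `q` the explicit constant of the paper. Then there are `κ₀, κ₁ > 0` such that
`𝓛_σ V_p(x) + ⟨b(x), ∇V_p(x)⟩ ≤ -κ₀ V_p(x)^{1+r/p} + κ₁` for all `x`, where
`V_p(x) = (1+|x|²)^{p/2}`. -/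
theorem stmt_0 (d : ℕ) (hd : 1 ≤ d) (α r p : ℝ)
    (hα : α ∈ Set.Ioo (0 : ℝ) 2) (hr : -α < r) (hp : p ∈ Set.Ioo (max (-r) 0) α)
    (b : EuclideanSpace ℝ (Fin d) → EuclideanSpace ℝ (Fin d))
    (σ : EuclideanSpace ℝ (Fin d) → Matrix (Fin d) (Fin d) ℝ)
    (hbm : Measurable b) (hσm : ∀ i j : Fin d, Measurable fun x => σ x i j)
    (hbloc : ∀ R : ℝ, ∃ C : ℝ, ∀ x : EuclideanSpace ℝ (Fin d), ‖x‖ ≤ R → ‖b x‖ ≤ C)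
    (hσloc : ∀ R : ℝ, ∃ C : ℝ, ∀ x : EuclideanSpace ℝ (Fin d), ‖x‖ ≤ R →
      ‖Matrix.toEuclideanCLM (𝕜 := ℝ) (σ x)‖ ≤ C)
    (c₀ c₁ : ℝ) (hc₀ : 0 < c₀) (hc₁ : 0 < c₁)
    (hdiss : ∀ x : EuclideanSpace ℝ (Fin d), 1 < ‖x‖ →
      (2 ^ (4 + 2 * α) * Real.pi ^ ((d : ℝ) / 2) * Real.Gamma (((d : ℝ) + α) / 2)
          / (Real.Gamma ((d : ℝ) / 2) ^ 2 * Real.Gamma ((2 - α) / 2))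
          * (α / (2 - α) + α / ((α - p) * p)))
        * ‖Matrix.toEuclideanCLM (𝕜 := ℝ) (σ x)‖ ^ α * ‖x‖ ^ (2 - α)
        + ⟪x, b x⟫ ≤ -c₀ * ‖x‖ ^ (2 + r) + c₁) :
    ∃ κ₀ > (0 : ℝ), ∃ κ₁ > (0 : ℝ), ∀ x : EuclideanSpace ℝ (Fin d),
      (α * 2 ^ α * Real.Gamma (((d : ℝ) + α) / 2)
          / (Real.Gamma ((d : ℝ) / 2) * Real.Gamma ((2 - α) / 2)))
        * (∫ z : EuclideanSpace ℝ (Fin d),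
            ((1 + ‖x + Matrix.toEuclideanCLM (𝕜 := ℝ) (σ x) z‖ ^ 2) ^ (p / 2)
              + (1 + ‖x - Matrix.toEuclideanCLM (𝕜 := ℝ) (σ x) z‖ ^ 2) ^ (p / 2)
              - 2 * (1 + ‖x‖ ^ 2) ^ (p / 2)) * ‖z‖ ^ (-(d : ℝ) - α))
        + ⟪b x, gradient (fun y : EuclideanSpace ℝ (Fin d) => (1 + ‖y‖ ^ 2) ^ (p / 2)) x⟫
      ≤ -κ₀ * ((1 + ‖x‖ ^ 2) ^ (p / 2)) ^ (1 + r / p) + κ₁ := by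
  obtain ⟨hα0, hα2⟩ := hα
  obtain ⟨hp1, hpα⟩ := hp
  have hp : 0 < p := (le_max_right _ _).trans_lt hp1
  have hpr : 0 < p + r := by have := (le_max_left (-r) 0).trans_lt hp1; linarith
  have hdp : (0 : ℝ) < d := by exact_mod_cast hd
  have h2α : 0 < 2 - α := by linarith
  have hαp : 0 < α - p := by linarith
  have hg1 : 0 < Gamma (((d : ℝ) + α) / 2) := Real.Gamma_pos_of_pos (by positivity)
  have hg2 : 0 < Gamma ((d : ℝ) / 2) := Real.Gamma_pos_of_pos (by positivity)
  have hg3 : 0 < Gamma ((2 - α) / 2) := Real.Gamma_pos_of_pos (by positivity)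
  set C : ℝ := α * 2 ^ α * Real.Gamma (((d : ℝ) + α) / 2)
          / (Real.Gamma ((d : ℝ) / 2) * Real.Gamma ((2 - α) / 2)) with hC
  have hC0 : 0 < C := by positivity
  set ω : ℝ := 2 * π ^ ((d : ℝ) / 2) / Gamma ((d : ℝ) / 2) with hω
  have hω0 : 0 < ω := by positivity
  set q : ℝ := 2 ^ (4 + 2 * α) * Real.pi ^ ((d : ℝ) / 2) * Real.Gamma (((d : ℝ) + α) / 2)
          / (Real.Gamma ((d : ℝ) / 2) ^ 2 * Real.Gamma ((2 - α) / 2))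
          * (α / (2 - α) + α / ((α - p) * p)) with hq
  have hqC : q = C * ω * (2 ^ (3 + α) * (1 / (2 - α) + 1 / ((α - p) * p))) := by
    have : (2 : ℝ) ^ (4 + 2 * α) = 2 * 2 ^ α * 2 ^ (3 + α) := by
      rw [mul_assoc, ← Real.rpow_add (by norm_num), ← Real.rpow_one_add' (by norm_num)
        (by linarith)]
      congr 1; ring
    rw [hq, hC, hω, this]
    field_simp
  have hV : ∀ x : EuclideanSpace ℝ (Fin d),
      ((1 + ‖x‖ ^ 2) ^ (p / 2)) ^ (1 + r / p) = (1 + ‖x‖ ^ 2) ^ ((p + r) / 2) := by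
    intro x
    rw [← Real.rpow_mul (by positivity)]
    congr 1
    field_simp
  obtain ⟨Mb, hMb⟩ := hbloc 1
  obtain ⟨Ms, hMs⟩ := hσloc 1
  set M₁ : ℝ := C * (ω * ((p * |Ms| ^ 2) * (1 / (2 - α)) + (2 * |Ms| ^ p) * (1 / (α - p))))
    with hM₁
  have hM₁0 : 0 ≤ M₁ := by positivity
  set κ₀ : ℝ := p * c₀ * (1 / 2) ^ ((2 + r) / 2) with hκ
  have hκ0 : 0 < κ₀ := by positivity
  refine ⟨κ₀, hκ0, p * c₁ + M₁ + p * |Mb| + κ₀ * 2 ^ ((p + r) / 2), by positivity, fun x => ?_⟩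
  rw [hV, aux_grad]
  set T := Matrix.toEuclideanCLM (𝕜 := ℝ) (σ x) with hT
  set w := (1 + ‖x‖ ^ 2) ^ (p / 2 - 1) with hw
  have hw0 : 0 < w := by positivity
  have hw1 : w ≤ 1 := Real.rpow_le_one_of_one_le_of_nonpos
    (le_add_of_nonneg_right (by positivity)) (by linarith)
  rcases le_or_gt ‖x‖ 1 with hx | hx
  · have hTM : ‖T‖ ≤ |Ms| := (hMs x hx).trans (le_abs_self _)
    have hI := aux_int d hd hα2 hp hpα one_pos T x
    rw [Real.one_rpow, Real.one_rpow] at hI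
    have h1 := mul_le_mul_of_nonneg_left hI hC0.le
    have h2 : C * (ω * ((p * w * ‖T‖ ^ 2) * (1 / (2 - α)) + (2 * ‖T‖ ^ p) * (1 / (α - p))))
        ≤ M₁ := by
      rw [hM₁]
      have : p * w ≤ p := mul_le_of_le_one_right hp.le hw1
      gcongr
    have h3 : p * w * ⟪x, b x⟫ ≤ p * |Mb| := by
      have : ⟪x, b x⟫ ≤ |Mb| := by
        refine (real_inner_le_norm _ _).trans ?_
        have := (hMb x hx).trans (le_abs_self _)
        exact (mul_le_mul hx this (norm_nonneg _) zero_le_one).trans_eq (one_mul _)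
      calc p * w * ⟪x, b x⟫ ≤ p * w * |Mb| := by gcongr
        _ ≤ p * 1 * |Mb| := by gcongr
        _ = _ := by ring
    have h4 : (1 + ‖x‖ ^ 2) ^ ((p + r) / 2) ≤ 2 ^ ((p + r) / 2) :=
      Real.rpow_le_rpow (by positivity) (by have := pow_le_one₀ (n := 2) (norm_nonneg x) hx; linarith)
        (by positivity)
    have h5 := mul_le_mul_of_nonneg_left h4 hκ0.le
    have h6 : 0 < p * c₁ := by positivity
    linarith
  · have hX0 : 0 < ‖x‖ := by linarith
    have hmain : C * (∫ z : EuclideanSpace ℝ (Fin d),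
            ((1 + ‖x + T z‖ ^ 2) ^ (p / 2) + (1 + ‖x - T z‖ ^ 2) ^ (p / 2)
              - 2 * (1 + ‖x‖ ^ 2) ^ (p / 2)) * ‖z‖ ^ (-(d : ℝ) - α))
        ≤ p * w * (q * ‖T‖ ^ α * ‖x‖ ^ (2 - α)) := by
      rcases (norm_nonneg T).eq_or_lt with h0 | h0
      · have hI := aux_int d hd hα2 hp hpα one_pos T x
        have h1 := mul_le_mul_of_nonneg_left hI hC0.le
        refine h1.trans (le_of_eq ?_)
        rw [← h0, Real.zero_rpow hα0.ne', Real.zero_rpow hp.ne']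
        ring
      · have hI := aux_int d hd hα2 hp hpα (div_pos hX0 h0) T x
        have h1 := mul_le_mul_of_nonneg_left hI hC0.le
        have h2 := mul_le_mul_of_nonneg_left (aux_scal hα0 hα2 hp hpα h0 hx)
          (mul_pos hC0 hω0).le
        rw [mul_assoc C ω] at h2
        refine (h1.trans h2).trans (le_of_eq ?_)
        rw [hqC]
        ring
    have hd2 := mul_le_mul_of_nonneg_left (hdiss x hx) (mul_pos hp hw0).le
    have h3 : κ₀ * (1 + ‖x‖ ^ 2) ^ ((p + r) / 2) ≤ p * w * (c₀ * ‖x‖ ^ (2 + r)) := by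
      have h1 : ((1 / 2) * (1 + ‖x‖ ^ 2)) ^ ((2 + r) / 2) ≤ (‖x‖ ^ 2) ^ ((2 + r) / 2) :=
        Real.rpow_le_rpow (by positivity) (by have := one_le_pow₀ (n := 2) hx.le; linarith)
          (by linarith)
      have h2 : (‖x‖ ^ 2) ^ ((2 + r) / 2) = ‖x‖ ^ (2 + r) := by
        rw [← Real.rpow_natCast, ← Real.rpow_mul hX0.le]
        congr 1
        push_cast
        ring
      rw [h2, Real.mul_rpow (by norm_num) (by positivity)] at h1
      have h4 : (1 + ‖x‖ ^ 2) ^ ((p + r) / 2) = w * (1 + ‖x‖ ^ 2) ^ ((2 + r) / 2) := by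
        rw [hw, ← Real.rpow_add (by positivity)]
        congr 1
        ring
      rw [h4, hκ]
      calc _ = p * w * (c₀ * ((1 / 2) ^ ((2 + r) / 2) * (1 + ‖x‖ ^ 2) ^ ((2 + r) / 2))) := by ring
        _ ≤ _ := by gcongr
    have h5 : p * w * c₁ ≤ p * c₁ := by
      have : p * c₁ * w ≤ p * c₁ * 1 := by gcongr
      linarith
    have h6 : 0 ≤ p * |Mb| := by positivity
    have h7 : 0 ≤ κ₀ * 2 ^ ((p + r) / 2) := by positivity
    linarith
end

section
/- Let d ≥ 1, α ∈ (0,2) and p ∈ (0, α). For every d×d real matrix M with operator norm ‖M‖ > 0 and every x ∈ ℝ^d with |x| > 1, one has (α 2^α Γ((d+α)/2) / (Γ(d/2) Γ((2−α)/2))) ∫_{ℝ^d} (V_p(x+Mz) + V_p(x−Mz) − 2 V_p(x)) |z|^{−d−α} dz ≤ p 2^{p/2−1} q ‖M‖^α |x|^{p−α}. -/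
open MeasureTheory Real

lemma aux_bound {p : ℝ} (hp : 0 < p) (hp2 : p < 2) {E : Type*} [NormedAddCommGroup E]
    [InnerProductSpace ℝ E] (x y : E) :
    (1 + ‖x + y‖ ^ 2) ^ (p / 2) + (1 + ‖x - y‖ ^ 2) ^ (p / 2) - 2 * (1 + ‖x‖ ^ 2) ^ (p / 2)
      ≤ 2 * (1 + ‖x‖ ^ 2 + ‖y‖ ^ 2) ^ (p / 2) - 2 * (1 + ‖x‖ ^ 2) ^ (p / 2) := by
  have hc0 : ConcaveOn ℝ (Set.Ici 0) (fun u : ℝ => u ^ (p / 2)) :=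
    Real.concaveOn_rpow (by linarith) (by linarith)
  obtain ⟨-, hc1⟩ := hc0
  have hm1 : 1 + ‖x + y‖ ^ 2 ∈ Set.Ici (0 : ℝ) := show (0:ℝ) ≤ _ by positivity
  have hm2 : 1 + ‖x - y‖ ^ 2 ∈ Set.Ici (0 : ℝ) := show (0:ℝ) ≤ _ by positivity
  have hc := hc1 hm1 hm2 (show (0 : ℝ) ≤ 1 / 2 by norm_num) (show (0 : ℝ) ≤ 1 / 2 by norm_num)
    (by norm_num)
  have hpar : (1 / 2 : ℝ) • (1 + ‖x + y‖ ^ 2) + (1 / 2 : ℝ) • (1 + ‖x - y‖ ^ 2)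
      = 1 + ‖x‖ ^ 2 + ‖y‖ ^ 2 := by
    have := parallelogram_law_with_norm ℝ x y
    simp only [smul_eq_mul]
    nlinarith
  rw [hpar] at hc
  simp only [smul_eq_mul] at hc
  linarith

lemma aux_small {p r s : ℝ} (hp : 0 < p) (hp2 : p < 2) (hr : 1 < r) :
    2 * (1 + r ^ 2 + s ^ 2) ^ (p / 2) - 2 * (1 + r ^ 2) ^ (p / 2) ≤ p * r ^ (p - 2) * s ^ 2 := by
  have ha : 0 < 1 + r ^ 2 := by positivity
  have h0 : 0 ≤ s ^ 2 / (1 + r ^ 2) := by positivity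
  have h1 : (1 + s ^ 2 / (1 + r ^ 2)) ^ (p / 2) ≤ 1 + (p / 2) * (s ^ 2 / (1 + r ^ 2)) :=
    rpow_one_add_le_one_add_mul_self (by linarith) (by linarith) (by linarith)
  have h2 : 1 + r ^ 2 + s ^ 2 = (1 + r ^ 2) * (1 + s ^ 2 / (1 + r ^ 2)) := by field_simp
  have h3 : (1 + r ^ 2) ^ (p / 2) = (1 + r ^ 2) ^ (p / 2 - 1) * (1 + r ^ 2) := by
    rw [Real.rpow_sub_one ha.ne']; field_simp
  have h4 : (1 + r ^ 2) ^ (p / 2 - 1) ≤ r ^ (p - 2) := by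
    have : r ^ (p - 2) = (r ^ 2) ^ (p / 2 - 1) := by
      rw [← Real.rpow_natCast r 2, ← Real.rpow_mul (by linarith)]
      congr 1; push_cast; ring
    rw [this]
    exact Real.rpow_le_rpow_of_nonpos (by positivity) (by linarith) (by linarith)
  rw [h2, Real.mul_rpow ha.le (by positivity)]
  calc 2 * ((1 + r ^ 2) ^ (p / 2) * (1 + s ^ 2 / (1 + r ^ 2)) ^ (p / 2)) - 2 * (1 + r ^ 2) ^ (p / 2)
      ≤ 2 * ((1 + r ^ 2) ^ (p / 2) * (1 + (p / 2) * (s ^ 2 / (1 + r ^ 2))))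
        - 2 * (1 + r ^ 2) ^ (p / 2) := by gcongr
    _ = p * (1 + r ^ 2) ^ (p / 2 - 1) * s ^ 2 := by rw [h3]; field_simp; ring
    _ ≤ _ := by gcongr

lemma aux_large {p r s : ℝ} (hp : 0 < p) (hp2 : p < 2) (hs : 0 ≤ s) :
    2 * (1 + r ^ 2 + s ^ 2) ^ (p / 2) - 2 * (1 + r ^ 2) ^ (p / 2) ≤ 2 * s ^ p := by
  have := Real.rpow_add_le_add_rpow (a := 1 + r ^ 2) (b := s ^ 2) (p := p / 2)
    (by positivity) (by positivity) (by linarith) (by linarith)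
  have h : (s ^ 2) ^ (p / 2) = s ^ p := by
    rw [← Real.rpow_natCast s 2, ← Real.rpow_mul hs]
    congr 1; push_cast; ring
  rw [h] at this
  linarith

lemma aux_1d {α p R A B : ℝ} (hα2 : α < 2) (hpα : p < α) (hR : 0 < R) (d : ℕ) (hd : 1 ≤ d) :
    IntegrableOn (fun t : ℝ => t ^ (d - 1) •
      ((if t ≤ R then A * t ^ 2 else B * t ^ p) * t ^ (-(d : ℝ) - α))) (Set.Ioi 0) ∧
    ∫ t in Set.Ioi (0 : ℝ), t ^ (d - 1) •
      ((if t ≤ R then A * t ^ 2 else B * t ^ p) * t ^ (-(d : ℝ) - α))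
      = A * (R ^ (2 - α) / (2 - α)) + B * (R ^ (p - α) / (α - p)) := by
  have hu : Set.Ioi (0 : ℝ) = Set.Ioc 0 R ∪ Set.Ioi R := (Set.Ioc_union_Ioi_eq_Ioi hR.le).symm
  have hdis : Disjoint (Set.Ioc 0 R) (Set.Ioi R) := Set.Ioc_disjoint_Ioi le_rfl
  have key : ∀ t : ℝ, 0 < t → t ^ (d - 1) * t ^ (-(d : ℝ) - α) = t ^ (-1 - α) := by
    intro t ht
    rw [← Real.rpow_natCast, ← Real.rpow_add ht, Nat.cast_sub hd]
    congr 1; push_cast; ring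
  have e1 : Set.EqOn (fun t : ℝ => t ^ (d - 1) •
      ((if t ≤ R then A * t ^ 2 else B * t ^ p) * t ^ (-(d : ℝ) - α)))
      (fun t => A * t ^ (1 - α)) (Set.Ioc 0 R) := by
    intro t ht
    have : t ^ (1 - α) = t ^ 2 * t ^ (-1 - α) := by
      rw [← Real.rpow_natCast, ← Real.rpow_add ht.1]; congr 1; push_cast; ring
    simp only [smul_eq_mul, if_pos ht.2]
    rw [this, ← key t ht.1]; ring
  have e2 : Set.EqOn (fun t : ℝ => t ^ (d - 1) •
      ((if t ≤ R then A * t ^ 2 else B * t ^ p) * t ^ (-(d : ℝ) - α)))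
      (fun t => B * t ^ (p - 1 - α)) (Set.Ioi R) := by
    intro t ht
    replace ht : R < t := ht
    have ht0 : 0 < t := hR.trans ht
    have : t ^ (p - 1 - α) = t ^ p * t ^ (-1 - α) := by
      rw [← Real.rpow_add ht0]; congr 1; ring
    simp only [smul_eq_mul, if_neg (not_le.mpr ht)]
    rw [this, ← key t ht0]; ring
  have i1' : IntegrableOn (fun t : ℝ => A * t ^ (1 - α)) (Set.Ioc 0 R) := by
    have := intervalIntegral.intervalIntegrable_rpow' (a := 0) (b := R) (r := 1 - α) (by linarith)
    exact ((intervalIntegrable_iff_integrableOn_Ioc_of_le hR.le).1 this).const_mul A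
  have i2' : IntegrableOn (fun t : ℝ => B * t ^ (p - 1 - α)) (Set.Ioi R) :=
    (integrableOn_Ioi_rpow_of_lt (by linarith) hR).const_mul B
  have i1 := i1'.congr_fun e1.symm measurableSet_Ioc
  have i2 := i2'.congr_fun e2.symm measurableSet_Ioi
  rw [hu]
  refine ⟨i1.union i2, ?_⟩
  rw [setIntegral_union hdis measurableSet_Ioi i1 i2, setIntegral_congr_fun measurableSet_Ioc e1,
    setIntegral_congr_fun measurableSet_Ioi e2, integral_const_mul, integral_const_mul,
    integral_Ioi_rpow_of_lt (by linarith) hR, ← intervalIntegral.integral_of_le hR.le,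
    integral_rpow (Or.inl (by linarith))]
  rw [show (1 - α + 1) = 2 - α by ring, show p - 1 - α + 1 = p - α by ring,
    Real.zero_rpow (by linarith), sub_zero, ← neg_sub α p, div_neg, neg_div, neg_neg]

/-- For `α ∈ (0,2)`, `p ∈ (0,α)`, any `d×d` real matrix `M` with
positive operator norm and any `x` with `|x| > 1`:
`c_{d,α} ∫ (V_p(x+Mz) + V_p(x-Mz) - 2V_p(x)) |z|^{-d-α} dz ≤ p 2^{p/2-1} q ‖M‖^α |x|^{p-α}`,
where `V_p(x) = (1+|x|²)^{p/2}` and `q` is the explicit constant of the paper. -/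
theorem stmt_1 (d : ℕ) (hd : 1 ≤ d) (α p : ℝ)
    (hα : α ∈ Set.Ioo (0 : ℝ) 2) (hp : p ∈ Set.Ioo (0 : ℝ) α)
    (M : Matrix (Fin d) (Fin d) ℝ) (hM : 0 < ‖Matrix.toEuclideanCLM (𝕜 := ℝ) M‖)
    (x : EuclideanSpace ℝ (Fin d)) (hx : 1 < ‖x‖) :
    (α * 2 ^ α * Real.Gamma (((d : ℝ) + α) / 2)
        / (Real.Gamma ((d : ℝ) / 2) * Real.Gamma ((2 - α) / 2)))
      * (∫ z : EuclideanSpace ℝ (Fin d),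
          ((1 + ‖x + Matrix.toEuclideanCLM (𝕜 := ℝ) M z‖ ^ 2) ^ (p / 2)
            + (1 + ‖x - Matrix.toEuclideanCLM (𝕜 := ℝ) M z‖ ^ 2) ^ (p / 2)
            - 2 * (1 + ‖x‖ ^ 2) ^ (p / 2)) * ‖z‖ ^ (-(d : ℝ) - α))
      ≤ p * 2 ^ (p / 2 - 1)
        * (2 ^ (4 + 2 * α) * Real.pi ^ ((d : ℝ) / 2) * Real.Gamma (((d : ℝ) + α) / 2)
            / (Real.Gamma ((d : ℝ) / 2) ^ 2 * Real.Gamma ((2 - α) / 2))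
            * (α / (2 - α) + α / ((α - p) * p)))
        * ‖Matrix.toEuclideanCLM (𝕜 := ℝ) M‖ ^ α * ‖x‖ ^ (p - α) := by
  obtain ⟨hα0, hα2⟩ := hα
  obtain ⟨hp0, hpα⟩ := hp
  have hp2 : p < 2 := hpα.trans hα2
  set T := Matrix.toEuclideanCLM (𝕜 := ℝ) M with hT
  set L := ‖T‖ with hL
  set r := ‖x‖ with hr
  have hr0 : 0 < r := by linarith
  have hd0 : (0 : ℝ) < d := by exact_mod_cast hd
  have : Nonempty (Fin d) := ⟨⟨0, hd⟩⟩
  have hG1 : 0 < Real.Gamma ((d : ℝ) / 2) := Real.Gamma_pos_of_pos (by positivity)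
  have hG2 : 0 < Real.Gamma ((2 - α) / 2) := Real.Gamma_pos_of_pos (by linarith)
  have hG3 : 0 < Real.Gamma (((d : ℝ) + α) / 2) := Real.Gamma_pos_of_pos (by positivity)
  have hα2' : 0 < 2 - α := by linarith
  have hαp : 0 < α - p := by linarith
  have hR : 0 < r / L := by positivity
  obtain ⟨hint, hval⟩ := aux_1d (A := p * r ^ (p - 2) * L ^ 2) (B := 2 * L ^ p) hα2 hpα hR d hd
  set g : ℝ → ℝ := fun t => (if t ≤ r / L then p * r ^ (p - 2) * L ^ 2 * t ^ 2
    else 2 * L ^ p * t ^ p) * t ^ (-(d : ℝ) - α) with hg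
  have hgint : Integrable (fun z : EuclideanSpace ℝ (Fin d) => g ‖z‖) := by
    rw [integrable_fun_norm_addHaar volume (f := g)]
    rw [finrank_euclideanSpace, Fintype.card_fin]
    exact hint
  have hgval : ∫ z : EuclideanSpace ℝ (Fin d), g ‖z‖
      = (2 * π ^ ((d : ℝ) / 2) / Real.Gamma ((d : ℝ) / 2))
        * ((p / (2 - α) + 2 / (α - p)) * (L ^ α * r ^ (p - α))) := by
    rw [integral_fun_norm_addHaar volume g]
    simp only [finrank_euclideanSpace, Fintype.card_fin]
    rw [hval]
    have hv : (volume : Measure (EuclideanSpace ℝ (Fin d))).real (Metric.ball 0 1)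
        = √π ^ d / Real.Gamma ((d : ℝ) / 2 + 1) := by
      rw [Measure.real, EuclideanSpace.volume_ball]
      have : 0 ≤ √π ^ d / Real.Gamma ((d : ℝ) / 2 + 1) := by
        rw [Real.Gamma_add_one (by positivity)]; positivity
      simp [ENNReal.toReal_ofReal this]
    have hpi : √π ^ d = π ^ ((d : ℝ) / 2) := by
      rw [Real.sqrt_eq_rpow, ← Real.rpow_natCast, ← Real.rpow_mul Real.pi_pos.le]
      congr 1; ring
    have e1 : r ^ (p - 2) * L ^ 2 * (r / L) ^ (2 - α) = L ^ α * r ^ (p - α) := by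
      rw [Real.div_rpow hr0.le hM.le, Real.rpow_sub hM, Real.rpow_sub hr0, Real.rpow_sub hr0,
        Real.rpow_sub hr0]
      simp only [Real.rpow_two]
      field_simp
    have e2 : L ^ p * (r / L) ^ (p - α) = L ^ α * r ^ (p - α) := by
      rw [Real.div_rpow hr0.le hM.le, Real.rpow_sub hM]
      field_simp
    rw [hv, hpi, Real.Gamma_add_one (by positivity)]
    simp only [nsmul_eq_mul, smul_eq_mul]
    have : p * r ^ (p - 2) * L ^ 2 * ((r / L) ^ (2 - α) / (2 - α))
        + 2 * L ^ p * ((r / L) ^ (p - α) / (α - p))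
        = (p / (2 - α) + 2 / (α - p)) * (L ^ α * r ^ (p - α)) := by
      calc _ = p / (2 - α) * (r ^ (p - 2) * L ^ 2 * (r / L) ^ (2 - α))
            + 2 / (α - p) * (L ^ p * (r / L) ^ (p - α)) := by ring
        _ = _ := by rw [e1, e2]; ring
    rw [this]
    field_simp
  have hpt : ∀ z : EuclideanSpace ℝ (Fin d),
      ((1 + ‖x + T z‖ ^ 2) ^ (p / 2) + (1 + ‖x - T z‖ ^ 2) ^ (p / 2)
            - 2 * (1 + r ^ 2) ^ (p / 2)) * ‖z‖ ^ (-(d : ℝ) - α) ≤ g ‖z‖ := by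
    intro z
    have hz : ‖T z‖ ≤ L * ‖z‖ := T.le_opNorm z
    apply mul_le_mul_of_nonneg_right _ (by positivity)
    refine (aux_bound hp0 hp2 x (T z)).trans ?_
    split_ifs with h
    · refine (aux_small hp0 hp2 hx).trans ?_
      calc p * r ^ (p - 2) * ‖T z‖ ^ 2 ≤ p * r ^ (p - 2) * (L * ‖z‖) ^ 2 := by gcongr
        _ = _ := by ring
    · refine (aux_large hp0 hp2 (norm_nonneg _)).trans ?_
      calc 2 * ‖T z‖ ^ p ≤ 2 * (L * ‖z‖) ^ p := by gcongr
        _ = _ := by rw [Real.mul_rpow hM.le (norm_nonneg _)]; ring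
  have hmono : (∫ z : EuclideanSpace ℝ (Fin d),
      ((1 + ‖x + T z‖ ^ 2) ^ (p / 2) + (1 + ‖x - T z‖ ^ 2) ^ (p / 2)
            - 2 * (1 + r ^ 2) ^ (p / 2)) * ‖z‖ ^ (-(d : ℝ) - α))
      ≤ (2 * π ^ ((d : ℝ) / 2) / Real.Gamma ((d : ℝ) / 2))
        * ((p / (2 - α) + 2 / (α - p)) * (L ^ α * r ^ (p - α))) := by
    by_cases hi : Integrable (fun z : EuclideanSpace ℝ (Fin d) =>
      ((1 + ‖x + T z‖ ^ 2) ^ (p / 2) + (1 + ‖x - T z‖ ^ 2) ^ (p / 2)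
            - 2 * (1 + r ^ 2) ^ (p / 2)) * ‖z‖ ^ (-(d : ℝ) - α))
    · rw [← hgval]
      exact integral_mono hi hgint hpt
    · rw [integral_undef hi]
      positivity
  have hconst : p / (2 - α) + 2 / (α - p)
      ≤ p * 2 ^ (p / 2 - 1) * 2 ^ (3 + α) * (1 / (2 - α) + 1 / ((α - p) * p)) := by
    have h4 : (2 : ℝ) ≤ 2 ^ (p / 2 - 1) * 2 ^ (3 + α) := by
      rw [← Real.rpow_add (by norm_num)]
      calc (2 : ℝ) = 2 ^ (1 : ℝ) := by simp
        _ ≤ _ := Real.rpow_le_rpow_of_exponent_le (by norm_num) (by linarith)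
    have h5 : 0 < p / (2 - α) := by positivity
    have h6 : 0 < 1 / (α - p) := by positivity
    calc p / (2 - α) + 2 / (α - p) ≤ 2 * (p / (2 - α) + 1 / (α - p)) := by
          have : 2 / (α - p) = 2 * (1 / (α - p)) := by ring
          linarith
      _ ≤ (2 ^ (p / 2 - 1) * 2 ^ (3 + α)) * (p / (2 - α) + 1 / (α - p)) := by gcongr
      _ = _ := by field_simp
  have h2 : (2 : ℝ) ^ (4 + 2 * α) = 2 * 2 ^ α * 2 ^ (3 + α) := by
    rw [mul_assoc, ← Real.rpow_add (by norm_num), ← Real.rpow_one_add' (by norm_num) (by linarith)]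
    congr 1; ring
  calc _ ≤ (α * 2 ^ α * Real.Gamma (((d : ℝ) + α) / 2)
        / (Real.Gamma ((d : ℝ) / 2) * Real.Gamma ((2 - α) / 2)))
        * ((2 * π ^ ((d : ℝ) / 2) / Real.Gamma ((d : ℝ) / 2))
        * ((p * 2 ^ (p / 2 - 1) * 2 ^ (3 + α) * (1 / (2 - α) + 1 / ((α - p) * p)))
          * (L ^ α * r ^ (p - α)))) := by
        apply mul_le_mul_of_nonneg_left _ (by positivity)
        refine hmono.trans ?_
        gcongr
    _ = _ := by
        rw [h2]
        ring
end

section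
/- Let d ≥ 1 and α ∈ (0,2). There exists a constant κ₀ > 0, depending only on d and α, such that for all x ∈ ℝ^d with x ≠ 0: |B(x)| ≤ κ₀ |x|^{1−d−α}. -/
open MeasureTheory Real

noncomputable section

/-- `ρ_α(x) = (1+|x|²)^{-(d+α)/2}`. -/
def rhoA (d : ℕ) (α : ℝ) (x : EuclideanSpace ℝ (Fin d)) : ℝ :=
  (1 + ‖x‖ ^ 2) ^ (-(((d : ℝ) + α) / 2))

/-- `c_{d,α} = 2^α Γ((d+α)/2) / (Γ(d/2) Γ((2-α)/2))`. -/
def cdA (d : ℕ) (α : ℝ) : ℝ :=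
  2 ^ α * Real.Gamma (((d : ℝ) + α) / 2)
    / (Real.Gamma ((d : ℝ) / 2) * Real.Gamma ((2 - α) / 2))

/-- `B(x) = c_{d,α} ∫ y (ρ_α(x+y) - ρ_α(x-y)) |y|^{-d-α} dy`. -/
def fieldB (d : ℕ) (α : ℝ) (x : EuclideanSpace ℝ (Fin d)) : EuclideanSpace ℝ (Fin d) :=
  cdA d α • ∫ y : EuclideanSpace ℝ (Fin d),
    ((rhoA d α (x + y) - rhoA d α (x - y)) * ‖y‖ ^ (-(d : ℝ) - α)) • y

/-- Lipschitz bound for a negative power on `[m, ∞)`. -/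
lemma aux_lip (p m a b : ℝ) (hp : 0 < p) (hm : 0 < m) (ha : m ≤ a) (hb : m ≤ b) :
    |a ^ (-p) - b ^ (-p)| ≤ p * m ^ (-p - 1) * |a - b| := by
  have h := Convex.norm_image_sub_le_of_norm_hasDerivWithin_le (s := Set.Ici m)
    (f := fun t : ℝ => t ^ (-p)) (f' := fun t : ℝ => -p * t ^ (-p - 1))
    (C := p * m ^ (-p - 1)) (x := b) (y := a)
    (fun t ht => (Real.hasDerivAt_rpow_const (Or.inl (lt_of_lt_of_le hm ht).ne')).hasDerivWithinAt)
    (fun t ht => by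
      have ht' : m ≤ t := ht
      have ht0 : 0 < t := lt_of_lt_of_le hm ht'
      rw [norm_mul, norm_neg, Real.norm_of_nonneg hp.le,
        Real.norm_of_nonneg (Real.rpow_nonneg ht0.le _)]
      exact mul_le_mul_of_nonneg_left
        (Real.rpow_le_rpow_of_nonpos hm ht' (by linarith)) hp.le)
    (convex_Ici m) hb ha
  simpa [Real.norm_eq_abs] using h

/-- Fixed integrable majorant of `min(|y|²,1)|y|^{-d-α}`. -/
def auxH (d : ℕ) (α : ℝ) (y : EuclideanSpace ℝ (Fin d)) : ℝ :=
  (Metric.ball (0 : EuclideanSpace ℝ (Fin d)) 1).indicator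
      (fun y => ‖y‖ ^ (2 - (d : ℝ) - α)) y
    + 2 ^ (((d : ℝ) + α) / 2) * rhoA d α y

lemma rhoA_nonneg (d : ℕ) (α : ℝ) (y : EuclideanSpace ℝ (Fin d)) : 0 ≤ rhoA d α y := by
  unfold rhoA; positivity

lemma rhoA_integrable (d : ℕ) (α : ℝ) (h0 : 0 < α) : Integrable (rhoA d α) := by
  have h := integrable_rpow_neg_one_add_norm_sq (E := EuclideanSpace ℝ (Fin d))
    (μ := volume) (r := (d : ℝ) + α) (by simp [h0])
  refine h.congr (Filter.Eventually.of_forall fun x => ?_)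
  simp only [rhoA, neg_div]

lemma auxH_nonneg (d : ℕ) (α : ℝ) (y : EuclideanSpace ℝ (Fin d)) : 0 ≤ auxH d α y := by
  unfold auxH
  have := rhoA_nonneg d α y
  have h2 : 0 ≤ (Metric.ball (0 : EuclideanSpace ℝ (Fin d)) 1).indicator
      (fun y => ‖y‖ ^ (2 - (d : ℝ) - α)) y :=
    Set.indicator_nonneg (fun _ _ => by positivity) _
  positivity

lemma auxH_integrable (d : ℕ) (hd : 1 ≤ d) (α : ℝ) (h0 : 0 < α) (h2 : α < 2) :
    Integrable (auxH d α) := by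
  refine Integrable.add ?_ ((rhoA_integrable d α h0).const_mul _)
  rw [integrable_indicator_iff Metric.isOpen_ball.measurableSet]
  refine integrableOn_ball_of_norm_le_rpow (C := 1) (α := (d : ℝ) + α - 2)
    (by simpa using hd) (by simp; linarith) ?_ ?_
  · refine Filter.Eventually.of_forall fun x => ?_
    rw [Real.norm_of_nonneg (by positivity), one_mul]
    apply le_of_eq; congr 1; ring
  · exact Measurable.aestronglyMeasurable (by fun_prop)

lemma auxH_bound (d : ℕ) (α : ℝ) (h0 : 0 < α) (s : ℝ) (hs : 1 ≤ s)
    (y : EuclideanSpace ℝ (Fin d)) (hy : y ≠ 0) (hys : ‖y‖ ≤ s) :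
    ‖y‖ ^ 2 * ‖y‖ ^ (-(d : ℝ) - α) ≤ s ^ 2 * auxH d α y := by
  have ht : 0 < ‖y‖ := norm_pos_iff.mpr hy
  have hr := rhoA_nonneg d α y
  by_cases h1 : ‖y‖ < 1
  · have e : ‖y‖ ^ 2 * ‖y‖ ^ (-(d : ℝ) - α) = ‖y‖ ^ (2 - (d : ℝ) - α) := by
      rw [← Real.rpow_natCast, ← Real.rpow_add ht]; congr 1; push_cast; ring
    have e2 : ‖y‖ ^ (2 - (d : ℝ) - α) ≤ auxH d α y := by
      unfold auxH
      rw [Set.indicator_of_mem (by simpa using h1)]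
      have : 0 ≤ (2:ℝ) ^ (((d : ℝ) + α) / 2) * rhoA d α y := by positivity
      linarith
    rw [e]
    have := auxH_nonneg d α y
    exact e2.trans (le_mul_of_one_le_left this (one_le_pow₀ hs))
  · push Not at h1
    have e2 : ‖y‖ ^ (-(d : ℝ) - α) ≤ auxH d α y := by
      unfold auxH
      rw [Set.indicator_of_notMem (by simpa using h1), zero_add, rhoA]
      have hle : (2 * ‖y‖ ^ 2) ^ (-(((d : ℝ) + α) / 2))
          ≤ (1 + ‖y‖ ^ 2) ^ (-(((d : ℝ) + α) / 2)) := by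
        apply Real.rpow_le_rpow_of_nonpos (by positivity) (by nlinarith)
        have : (0:ℝ) ≤ d := by positivity
        linarith
      have heq : (2:ℝ) ^ (((d : ℝ) + α) / 2) * (2 * ‖y‖ ^ 2) ^ (-(((d : ℝ) + α) / 2))
          = ‖y‖ ^ (-(d : ℝ) - α) := by
        rw [Real.mul_rpow (by norm_num) (by positivity), ← mul_assoc,
          ← Real.rpow_add (by norm_num), add_neg_cancel, Real.rpow_zero, one_mul,
          ← Real.rpow_natCast, ← Real.rpow_mul ht.le]
        congr 1; push_cast; ring
      rw [← heq]
      exact mul_le_mul_of_nonneg_left hle (by positivity)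
    have : ‖y‖ ^ 2 ≤ s ^ 2 := by gcongr
    gcongr

lemma rho_diff (d : ℕ) (α : ℝ) (h0 : 0 < α) (x y : EuclideanSpace ℝ (Fin d))
    (hy : ‖y‖ ≤ (1 + ‖x‖) / 2) :
    |rhoA d α (x + y) - rhoA d α (x - y)| ≤
      4 * (((d : ℝ) + α) / 2) * 8 ^ (((d : ℝ) + α) / 2 + 1)
        * (1 + ‖x‖) ^ (-1 - (d : ℝ) - α) * ‖y‖ := by
  set s := 1 + ‖x‖ with hs
  set p := ((d : ℝ) + α) / 2 with hp
  have hs1 : 0 < s := by positivity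
  have hp0 : 0 < p := by positivity
  have key : ∀ z : EuclideanSpace ℝ (Fin d), ‖x‖ - ‖y‖ ≤ ‖z‖ → s ^ 2 / 8 ≤ 1 + ‖z‖ ^ 2 := by
    intro z hz
    have h1 : s / 2 ≤ 1 + ‖z‖ := by linarith
    have h2 : (s / 2) ^ 2 ≤ (1 + ‖z‖) ^ 2 := by gcongr
    nlinarith [sq_nonneg (1 - ‖z‖)]
  have ha := key (x + y) (by
    have := norm_sub_norm_le x (-y); simpa using this)
  have hb := key (x - y) (norm_sub_norm_le x y)
  have h := aux_lip p (s ^ 2 / 8) _ _ hp0 (by positivity) ha hb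
  have hab : |(1 + ‖x + y‖ ^ 2) - (1 + ‖x - y‖ ^ 2)| ≤ 4 * (s * ‖y‖) := by
    have e : (1 + ‖x + y‖ ^ 2) - (1 + ‖x - y‖ ^ 2) = 4 * inner ℝ x y := by
      rw [norm_add_sq_real, norm_sub_sq_real]; ring
    rw [e, abs_mul, abs_of_pos (by norm_num : (0:ℝ) < 4)]
    have := abs_real_inner_le_norm x y
    have h3 : ‖x‖ * ‖y‖ ≤ s * ‖y‖ := by gcongr; linarith
    linarith
  have em : (s ^ 2 / 8) ^ (-p - 1) = 8 ^ (p + 1) * s ^ (-2 - (d : ℝ) - α) := by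
    rw [Real.div_rpow (by positivity) (by norm_num), ← Real.rpow_natCast, ← Real.rpow_mul hs1.le,
      div_eq_mul_inv, ← Real.rpow_neg (by norm_num), mul_comm]
    congr 2
    · ring
    · rw [hp]; push_cast; ring
  have es : s ^ (-2 - (d : ℝ) - α) * s = s ^ (-1 - (d : ℝ) - α) := by
    rw [← Real.rpow_add_one hs1.ne']; congr 1; ring
  unfold rhoA
  calc _ ≤ p * (s ^ 2 / 8) ^ (-p - 1) * |(1 + ‖x + y‖ ^ 2) - (1 + ‖x - y‖ ^ 2)| := h
    _ ≤ p * (s ^ 2 / 8) ^ (-p - 1) * (4 * (s * ‖y‖)) := by gcongr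
    _ = _ := by rw [em, ← es]; ring

lemma pointwise_bound (d : ℕ) (hd : 1 ≤ d) (α : ℝ) (h0 : 0 < α)
    (x y : EuclideanSpace ℝ (Fin d)) :
    ‖((rhoA d α (x + y) - rhoA d α (x - y)) * ‖y‖ ^ (-(d : ℝ) - α)) • y‖ ≤
      (1 + ‖x‖) ^ (1 - (d : ℝ) - α) *
        (4 * (((d : ℝ) + α) / 2) * 8 ^ (((d : ℝ) + α) / 2 + 1) * auxH d α y
          + 2 ^ ((d : ℝ) + α - 1) * (rhoA d α (x + y) + rhoA d α (x - y))) := by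
  set s := 1 + ‖x‖ with hs
  have hs1 : 1 ≤ s := by have := norm_nonneg x; linarith
  have hs0 : 0 < s := by linarith
  have hH := auxH_nonneg d α y
  have hra := rhoA_nonneg d α (x + y)
  have hrb := rhoA_nonneg d α (x - y)
  set C := 4 * (((d : ℝ) + α) / 2) * 8 ^ (((d : ℝ) + α) / 2 + 1) with hC
  have hC0 : 0 ≤ C := by positivity
  rcases eq_or_ne y 0 with rfl | hy
  · simp only [smul_zero, norm_zero]; positivity
  have ht : 0 < ‖y‖ := norm_pos_iff.mpr hy
  rw [norm_smul, norm_mul, Real.norm_eq_abs,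
    Real.norm_of_nonneg (Real.rpow_nonneg ht.le _)]
  rw [mul_add]
  by_cases hys : ‖y‖ ≤ s / 2
  · have h1 := rho_diff d α h0 x y hys
    have h2 := auxH_bound d α h0 s hs1 y hy (by linarith)
    have es : s ^ (-1 - (d : ℝ) - α) * s ^ 2 = s ^ (1 - (d : ℝ) - α) := by
      rw [← Real.rpow_natCast, ← Real.rpow_add hs0]; congr 1; push_cast; ring
    have h3 : 0 ≤ s ^ (1 - (d : ℝ) - α) *
      (2 ^ ((d : ℝ) + α - 1) * (rhoA d α (x + y) + rhoA d α (x - y))) := by positivity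
    calc _ ≤ C * s ^ (-1 - (d : ℝ) - α) * ‖y‖ * ‖y‖ ^ (-(d : ℝ) - α) * ‖y‖ := by gcongr
      _ = C * s ^ (-1 - (d : ℝ) - α) * (‖y‖ ^ 2 * ‖y‖ ^ (-(d : ℝ) - α)) := by ring
      _ ≤ C * s ^ (-1 - (d : ℝ) - α) * (s ^ 2 * auxH d α y) := by gcongr
      _ = s ^ (1 - (d : ℝ) - α) * (C * auxH d α y) := by rw [← es]; ring
      _ ≤ _ := by linarith
  · push Not at hys
    have h1 : |rhoA d α (x + y) - rhoA d α (x - y)| ≤ rhoA d α (x + y) + rhoA d α (x - y) := by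
      rw [abs_le]; constructor <;> linarith
    have hd' : (1:ℝ) ≤ d := by exact_mod_cast hd
    have h2 : ‖y‖ ^ (-(d : ℝ) - α) * ‖y‖ ≤ s ^ (1 - (d : ℝ) - α) * 2 ^ ((d : ℝ) + α - 1) := by
      have e1 : ‖y‖ ^ (-(d : ℝ) - α) * ‖y‖ = ‖y‖ ^ (1 - (d : ℝ) - α) := by
        rw [← Real.rpow_add_one ht.ne']; congr 1; ring
      have e2 : s ^ (1 - (d : ℝ) - α) * 2 ^ ((d : ℝ) + α - 1) = (s / 2) ^ (1 - (d : ℝ) - α) := by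
        rw [Real.div_rpow hs0.le (by norm_num), div_eq_mul_inv, ← Real.rpow_neg (by norm_num)]
        congr 2; ring
      rw [e1, e2]
      exact Real.rpow_le_rpow_of_nonpos (by positivity) hys.le (by linarith)
    have h3 : 0 ≤ s ^ (1 - (d : ℝ) - α) * (C * auxH d α y) := by positivity
    calc _ = |rhoA d α (x + y) - rhoA d α (x - y)| * (‖y‖ ^ (-(d : ℝ) - α) * ‖y‖) := by ring
      _ ≤ (rhoA d α (x + y) + rhoA d α (x - y)) *
          (s ^ (1 - (d : ℝ) - α) * 2 ^ ((d : ℝ) + α - 1)) := by gcongr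
      _ ≤ _ := by linarith

/-- **Lemma 4.1(i), first bound.** There is `κ₀ > 0` depending only on
`d, α` such that `|B(x)| ≤ κ₀ |x|^{1-d-α}` for all `x ≠ 0`. -/
theorem stmt_11 (d : ℕ) (hd : 1 ≤ d) (α : ℝ) (hα : α ∈ Set.Ioo (0 : ℝ) 2) :
    ∃ κ₀ > (0 : ℝ), ∀ x : EuclideanSpace ℝ (Fin d), x ≠ 0 →
      ‖fieldB d α x‖ ≤ κ₀ * ‖x‖ ^ (1 - (d : ℝ) - α) := by
  obtain ⟨h0, h2⟩ := hα
  have hd' : (1:ℝ) ≤ d := by exact_mod_cast hd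
  set C := 4 * (((d : ℝ) + α) / 2) * 8 ^ (((d : ℝ) + α) / 2 + 1) with hC
  set D := (2:ℝ) ^ ((d : ℝ) + α - 1) with hD
  set K := C * (∫ y, auxH d α y) + D * ((∫ y, rhoA d α y) + ∫ y, rhoA d α y) with hK
  have hK0 : 0 ≤ K := by
    have i1 : 0 ≤ ∫ y, auxH d α y := integral_nonneg (auxH_nonneg d α)
    have i2 : 0 ≤ ∫ y, rhoA d α y := integral_nonneg (rhoA_nonneg d α)
    positivity
  refine ⟨|cdA d α| * K + 1, by positivity, fun x hx => ?_⟩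
  have hx0 : 0 < ‖x‖ := norm_pos_iff.mpr hx
  have hr := rhoA_integrable d α h0
  have hH := auxH_integrable d hd α h0 h2
  have ia : Integrable (fun y => rhoA d α (x + y)) := hr.comp_add_left x
  have ib : Integrable (fun y => rhoA d α (x - y)) := hr.comp_sub_left x
  have iab : Integrable (fun y => D * (rhoA d α (x + y) + rhoA d α (x - y))) :=
    (ia.add ib).const_mul D
  have hb := norm_integral_le_of_norm_le
    (((hH.const_mul C).add ((ia.add ib).const_mul D)).const_mul
      ((1 + ‖x‖) ^ (1 - (d : ℝ) - α)))
    (Filter.Eventually.of_forall fun y => pointwise_bound d hd α h0 x y)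
  have hI : ∫ y, (1 + ‖x‖) ^ (1 - (d : ℝ) - α) *
      (C * auxH d α y + D * (rhoA d α (x + y) + rhoA d α (x - y)))
      = (1 + ‖x‖) ^ (1 - (d : ℝ) - α) * K := by
    rw [integral_const_mul, integral_add (hH.const_mul C) iab,
      integral_const_mul, integral_const_mul, integral_add ia ib,
      integral_add_left_eq_self (rhoA d α) x, integral_sub_left_eq_self (rhoA d α) volume x]
  have hb' := hb.trans_eq hI
  have hle : (1 + ‖x‖) ^ (1 - (d : ℝ) - α) ≤ ‖x‖ ^ (1 - (d : ℝ) - α) :=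
    Real.rpow_le_rpow_of_nonpos hx0 (by linarith) (by linarith)
  have hpos : 0 ≤ ‖x‖ ^ (1 - (d : ℝ) - α) := by positivity
  unfold fieldB
  rw [norm_smul, Real.norm_eq_abs]
  calc _ ≤ |cdA d α| * ((1 + ‖x‖) ^ (1 - (d : ℝ) - α) * K) := by gcongr
    _ ≤ |cdA d α| * (‖x‖ ^ (1 - (d : ℝ) - α) * K) := by gcongr
    _ ≤ _ := by linarith
end
end

section
/- Let d ≥ 1 and α ∈ (0,2). The vector field B is continuously differentiable on ℝ^d, and there exists a constant κ₀ > 0, depending only on d and α, such that for all x ∈ ℝ^d with x ≠ 0 the Jacobian matrix ∇B(x) satisfies ‖∇B(x)‖ ≤ κ₀ |x|^{−d−α}. -/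
open MeasureTheory Real

noncomputable section

abbrev EE (d : ℕ) := EuclideanSpace ℝ (Fin d)

/-- The vector field `(1+|z|²)^(-p) z`. -/
def GG (d : ℕ) (p : ℝ) (z : EE d) : EE d := ((1 + ‖z‖ ^ 2) ^ (-p)) • z

/-- Derivative of `rhoA`. -/
def drho (d : ℕ) (α : ℝ) (z : EE d) : EE d →L[ℝ] ℝ :=
  (-((d : ℝ) + α)) • innerSL ℝ (GG d (((d : ℝ) + α) / 2 + 1) z)

lemma w_pos {d : ℕ} (z : EE d) : (0:ℝ) < 1 + ‖z‖ ^ 2 := by positivity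

lemma w_ge {d : ℕ} (z : EE d) : (1:ℝ) ≤ 1 + ‖z‖ ^ 2 := by
  have : 0 ≤ ‖z‖ ^ 2 := by positivity
  linarith

lemma hasFDerivAt_w {d : ℕ} (q : ℝ) (z : EE d) :
    HasFDerivAt (fun z : EE d => (1 + ‖z‖ ^ 2) ^ q)
      ((2 * q * (1 + ‖z‖ ^ 2) ^ (q - 1)) • innerSL ℝ z) z := by
  have h1 : HasFDerivAt (fun z : EE d => 1 + ‖z‖ ^ 2) (2 • (innerSL ℝ z)) z :=
    (hasStrictFDerivAt_norm_sq z).hasFDerivAt.const_add 1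
  have h2 := h1.rpow_const (p := q) (Or.inl (w_pos z).ne')
  refine h2.congr_fderiv ?_
  ext v
  simp
  ring

lemma hasFDerivAt_rho (d : ℕ) (α : ℝ) (z : EE d) :
    HasFDerivAt (rhoA d α) (drho d α z) z := by
  have h := hasFDerivAt_w (-(((d : ℝ) + α) / 2)) z
  unfold drho GG rhoA
  refine h.congr_fderiv ?_
  rw [show -(((d : ℝ) + α) / 2) - 1 = -(((d : ℝ) + α) / 2 + 1) by ring]
  ext v
  simp
  ring

lemma GG_deriv (d : ℕ) (p : ℝ) (hp : 0 ≤ p) (z : EE d) :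
    ∃ L : EE d →L[ℝ] EE d, HasFDerivAt (GG d p) L z ∧
      ‖L‖ ≤ (1 + 2 * p) * (1 + ‖z‖ ^ 2) ^ (-p) := by
  have h := (hasFDerivAt_w (-p) z).smul (hasFDerivAt_id z)
  refine ⟨_, h, ?_⟩
  have hw := w_pos z
  have hq : 0 ≤ (1 + ‖z‖ ^ 2) ^ (-p) := by positivity
  refine (norm_add_le _ _).trans ?_
  have e1 : ‖((1 + ‖z‖ ^ 2) ^ (-p)) • ContinuousLinearMap.id ℝ (EE d)‖ ≤ (1 + ‖z‖ ^ 2) ^ (-p) := by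
    rw [norm_smul, Real.norm_of_nonneg hq]
    exact mul_le_of_le_one_right hq ContinuousLinearMap.norm_id_le
  have e2 : ‖ContinuousLinearMap.smulRight
      ((2 * (-p) * (1 + ‖z‖ ^ 2) ^ (-p - 1)) • innerSL ℝ z) z‖
      ≤ 2 * p * (1 + ‖z‖ ^ 2) ^ (-p) := by
    rw [ContinuousLinearMap.norm_smulRight_apply, norm_smul, innerSL_apply_norm,
      Real.norm_eq_abs, abs_mul, abs_mul, abs_neg, abs_of_nonneg hp,
      abs_of_pos (Real.rpow_pos_of_pos hw _), Real.rpow_sub_one hw.ne', abs_two]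
    have : ‖z‖ * ‖z‖ ≤ 1 + ‖z‖ ^ 2 := by nlinarith
    calc _ = 2 * p * ((1 + ‖z‖ ^ 2) ^ (-p) * (‖z‖ * ‖z‖ / (1 + ‖z‖ ^ 2))) := by ring
      _ ≤ _ := by
        gcongr
        exact mul_le_of_le_one_right hq ((div_le_one hw).2 this)
  calc _ ≤ _ := add_le_add e1 e2
    _ = _ := by ring

lemma GG_norm (d : ℕ) (p : ℝ) (z : EE d) : ‖GG d (p + 1) z‖ ≤ (1 + ‖z‖ ^ 2) ^ (-p) := by
  have hw := w_pos z
  have hq : 0 ≤ (1 + ‖z‖ ^ 2) ^ (-p) := by positivity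
  unfold GG
  rw [norm_smul, Real.norm_of_nonneg (by positivity), show -(p + 1) = -p - 1 by ring,
    Real.rpow_sub_one hw.ne', div_mul_eq_mul_div, mul_div_assoc]
  apply mul_le_of_le_one_right hq
  rw [div_le_one hw]
  nlinarith [sq_nonneg (‖z‖ - 1)]

lemma GG_lip (d : ℕ) (p : ℝ) (hp : 0 ≤ p) (S : Set (EE d)) (hS : Convex ℝ S) (R : ℝ) (hR : 0 ≤ R)
    (h : ∀ z ∈ S, R ≤ ‖z‖) (a b : EE d) (ha : a ∈ S) (hb : b ∈ S) :
    ‖GG d p a - GG d p b‖ ≤ (1 + 2 * p) * (1 + R ^ 2) ^ (-p) * ‖a - b‖ := by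
  choose L hL hL' using GG_deriv d p hp
  refine hS.norm_image_sub_le_of_norm_hasFDerivWithin_le (f := GG d p) (f' := L)
    (fun z _ => (hL z).hasFDerivWithinAt) (fun z hz => (hL' z).trans ?_) hb ha
  have h1 := h z hz
  have : (1 + ‖z‖ ^ 2) ^ (-p) ≤ (1 + R ^ 2) ^ (-p) :=
    Real.rpow_le_rpow_of_nonpos (by positivity) (by gcongr) (by linarith)
  gcongr

lemma drho_sub (d : ℕ) (α : ℝ) (hα : 0 < α) (a b : EE d) :
    ‖drho d α a - drho d α b‖ =
      (d + α) * ‖GG d (((d : ℝ) + α) / 2 + 1) a - GG d (((d : ℝ) + α) / 2 + 1) b‖ := by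
  have : drho d α a - drho d α b = (-((d : ℝ) + α)) • innerSL ℝ
      (GG d (((d : ℝ) + α) / 2 + 1) a - GG d (((d : ℝ) + α) / 2 + 1) b) := by
    unfold drho
    ext v
    simp
    ring
  rw [this, norm_smul, innerSL_apply_norm, norm_neg,
    Real.norm_of_nonneg (by positivity)]

lemma drho_norm (d : ℕ) (α : ℝ) (hα : 0 < α) (a : EE d) :
    ‖drho d α a‖ ≤ (d + α) * rhoA d α a := by
  unfold drho
  rw [norm_smul, innerSL_apply_norm, norm_neg, Real.norm_of_nonneg (by positivity)]
  gcongr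
  exact GG_norm d _ a

lemma drho_lip (d : ℕ) (α : ℝ) (hα : 0 < α) (S : Set (EE d)) (hS : Convex ℝ S) (R : ℝ) (hR : 0 ≤ R)
    (h : ∀ z ∈ S, R ≤ ‖z‖) (a b : EE d) (ha : a ∈ S) (hb : b ∈ S) :
    ‖drho d α a - drho d α b‖ ≤
      (d + α) * (d + α + 3) * (1 + R ^ 2) ^ (-((d + α) / 2 + 1)) * ‖a - b‖ := by
  rw [drho_sub d α hα]
  have := GG_lip d (((d : ℝ) + α) / 2 + 1) (by positivity) S hS R hR h a b ha hb
  have h2 := mul_le_mul_of_nonneg_left this (show (0:ℝ) ≤ d + α by positivity)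
  refine h2.trans (le_of_eq ?_)
  ring

lemma drho_lip0 (d : ℕ) (α : ℝ) (hα : 0 < α) (a b : EE d) :
    ‖drho d α a - drho d α b‖ ≤ (d + α) * (d + α + 3) * ‖a - b‖ := by
  simpa using drho_lip d α hα Set.univ convex_univ 0 le_rfl (fun z _ => norm_nonneg z) a b
    trivial trivial

lemma continuous_drho (d : ℕ) (α : ℝ) (hα : 0 < α) : Continuous (drho d α) := by
  have : LipschitzWith (Real.toNNReal ((d + α) * (d + α + 3))) (drho d α) := by
    apply LipschitzWith.of_dist_le_mul
    intro a b
    rw [dist_eq_norm, dist_eq_norm, Real.coe_toNNReal _ (by positivity)]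
    exact drho_lip0 d α hα a b
  exact this.continuous

lemma rho_pos (d : ℕ) (α : ℝ) (a : EE d) : 0 < rhoA d α a := Real.rpow_pos_of_pos (w_pos a) _

lemma rho_le_one (d : ℕ) (α : ℝ) (hα : 0 < α) (a : EE d) : rhoA d α a ≤ 1 := by
  have : (0:ℝ) ≤ (d + α) / 2 := by positivity
  exact Real.rpow_le_one_of_one_le_of_nonpos (w_ge a) (by linarith)

lemma continuous_rho (d : ℕ) (α : ℝ) : Continuous (rhoA d α) :=
  continuous_iff_continuousAt.2 fun z => (hasFDerivAt_rho d α z).continuousAt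

lemma rho_lip (d : ℕ) (α : ℝ) (hα : 0 < α) (a b : EE d) :
    |rhoA d α a - rhoA d α b| ≤ (d + α) * ‖a - b‖ := by
  refine convex_univ.norm_image_sub_le_of_norm_hasFDerivWithin_le (f := rhoA d α) (f' := drho d α)
    (fun z _ => (hasFDerivAt_rho d α z).hasFDerivWithinAt) (fun z _ => ?_) trivial trivial
  refine (drho_norm d α hα z).trans ?_
  exact mul_le_of_le_one_right (by positivity) (rho_le_one d α hα z)

lemma rho_shift (d : ℕ) (α : ℝ) (hα : 0 < α) (M : ℝ) (x y : EE d) (hx : ‖x‖ ≤ M) :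
    rhoA d α (x + y) ≤ (2 + 2 * M ^ 2) ^ (((d : ℝ) + α) / 2) * rhoA d α y := by
  have hM : 0 ≤ M := (norm_nonneg x).trans hx
  have h1 : 1 + ‖y‖ ^ 2 ≤ (2 + 2 * M ^ 2) * (1 + ‖x + y‖ ^ 2) := by
    have : ‖y‖ ≤ ‖x + y‖ + M := by
      calc ‖y‖ = ‖(x + y) - x‖ := by simp
        _ ≤ ‖x + y‖ + ‖x‖ := norm_sub_le _ _
        _ ≤ _ := by gcongr
    have h2 : ‖y‖ ^ 2 ≤ (‖x + y‖ + M) ^ 2 := by gcongr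
    nlinarith [sq_nonneg (‖x + y‖ - M), mul_nonneg (sq_nonneg M) (sq_nonneg ‖x + y‖)]
  unfold rhoA
  rw [Real.rpow_neg (w_pos _).le, Real.rpow_neg (w_pos _).le, ← div_eq_mul_inv,
    le_div_iff₀ (Real.rpow_pos_of_pos (w_pos y) _), inv_mul_le_iff₀ (Real.rpow_pos_of_pos (w_pos _) _),
    mul_comm, ← Real.mul_rpow (by positivity) (by positivity)]
  exact Real.rpow_le_rpow (by positivity) h1 (by positivity)

lemma rho_integrable (d : ℕ) (α : ℝ) (hα : 0 < α) : Integrable (rhoA d α) := by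
  have := integrable_rpow_neg_one_add_norm_sq (E := EE d) (μ := volume) (r := d + α) (by simp [hα])
  convert this using 2
  unfold rhoA
  congr 1
  ring

/-- radial truncated power -/
def qq (s R r : ℝ) : ℝ := Set.indicator (Set.Iic R) (fun r => r ^ (2 - s)) r

lemma qq_nonneg (s R r : ℝ) (hr : 0 ≤ r) : 0 ≤ qq s R r := by
  unfold qq
  by_cases h : r ∈ Set.Iic R
  · rw [Set.indicator_of_mem h]; positivity
  · rw [Set.indicator_of_notMem h]

lemma qq_aux (d : ℕ) (hd : 1 ≤ d) (α R : ℝ) {y : ℝ} (hy : 0 < y) :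
    y ^ (d - 1) • qq (d + α) R y = Set.indicator (Set.Iic R) (fun r => r ^ (1 - α)) y := by
  unfold qq
  by_cases h : y ∈ Set.Iic R
  · rw [Set.indicator_of_mem h, Set.indicator_of_mem h, smul_eq_mul, ← Real.rpow_natCast,
      ← Real.rpow_add hy, Nat.cast_sub hd]
    congr 1
    push_cast
    ring
  · rw [Set.indicator_of_notMem h, Set.indicator_of_notMem h, smul_zero]

lemma qq_integrable (d : ℕ) (hd : 1 ≤ d) (α : ℝ) (h2 : α < 2) (R : ℝ) (hR : 0 < R) :
    Integrable (fun y : EE d => qq (d + α) R ‖y‖) := by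
  have : Nonempty (Fin d) := ⟨⟨0, hd⟩⟩
  rw [integrable_fun_norm_addHaar volume (f := qq (d + α) R), finrank_euclideanSpace_fin,
    integrableOn_congr_fun (fun y (hy : y ∈ Set.Ioi (0:ℝ)) => qq_aux d hd α R (y := y) hy) measurableSet_Ioi,
    integrableOn_indicator_iff measurableSet_Iic, Set.inter_comm, Set.Ioi_inter_Iic]
  exact (intervalIntegrable_iff_integrableOn_Ioc_of_le hR.le).1
    (intervalIntegral.intervalIntegrable_rpow' (by linarith))

lemma qq_integral (d : ℕ) (hd : 1 ≤ d) (α : ℝ) (h2 : α < 2) (R : ℝ) (hR : 0 < R) :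
    ∫ y : EE d, qq (d + α) R ‖y‖ =
      (d * (volume : Measure (EE d)).real (Metric.ball 0 1) / (2 - α)) * R ^ (2 - α) := by
  have : Nonempty (Fin d) := ⟨⟨0, hd⟩⟩
  rw [integral_fun_norm_addHaar volume (f := qq (d + α) R), finrank_euclideanSpace_fin,
    setIntegral_congr_fun measurableSet_Ioi (fun y (hy : y ∈ Set.Ioi (0:ℝ)) => qq_aux d hd α R (y := y) hy),
    setIntegral_indicator measurableSet_Iic, Set.Ioi_inter_Iic,
    ← intervalIntegral.integral_of_le hR.le, integral_rpow (Or.inl (by linarith)),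
    Real.zero_rpow (by linarith), show 1 - α + 1 = 2 - α by ring]
  simp only [smul_eq_mul, nsmul_eq_mul]
  ring

lemma dom (d : ℕ) (hd : 1 ≤ d) (α : ℝ) (hα : 0 < α) (y : EE d) (a C D : ℝ)
    (hC : 0 ≤ C) (hD : 0 ≤ D) (h1 : a ≤ C * ‖y‖) (h2 : a ≤ D * rhoA d α y) :
    a * (‖y‖ ^ (-(d : ℝ) - α) * ‖y‖) ≤ C * qq (d + α) 1 ‖y‖ + D * rhoA d α y := by
  have hρ := (rho_pos d α y).le
  have hN : 0 ≤ ‖y‖ ^ (-(d : ℝ) - α) * ‖y‖ := by positivity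
  have hqn := qq_nonneg (d + α) 1 ‖y‖ (norm_nonneg y)
  have hd' : (1:ℝ) ≤ d := by exact_mod_cast hd
  rcases eq_or_ne y 0 with rfl | hy
  · simp only [norm_zero, mul_zero] at *
    positivity
  have hy' : 0 < ‖y‖ := norm_pos_iff.2 hy
  by_cases h : ‖y‖ ≤ 1
  · have hq : qq (d + α) 1 ‖y‖ = ‖y‖ ^ (-(d : ℝ) - α) * ‖y‖ * ‖y‖ := by
      unfold qq
      rw [Set.indicator_of_mem (show ‖y‖ ∈ Set.Iic (1:ℝ) from h), ← Real.rpow_add_one hy'.ne',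
        ← Real.rpow_add_one hy'.ne']
      congr 1
      ring
    have := mul_le_mul_of_nonneg_right h1 hN
    have h3 : 0 ≤ D * rhoA d α y := by positivity
    rw [hq]
    linarith
  · push Not at h
    have hN1 : ‖y‖ ^ (-(d : ℝ) - α) * ‖y‖ ≤ 1 := by
      rw [← Real.rpow_add_one hy'.ne']
      exact Real.rpow_le_one_of_one_le_of_nonpos h.le (by linarith)
    have h3 : 0 ≤ D * rhoA d α y := by positivity
    have h4 : 0 ≤ C * qq (d + α) 1 ‖y‖ := by positivity
    have h5 := mul_le_mul_of_nonneg_right h2 hN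
    nlinarith

/-- The integrand. -/
def FF (d : ℕ) (α : ℝ) (x y : EE d) : EE d :=
  ((rhoA d α (x + y) - rhoA d α (x - y)) * ‖y‖ ^ (-(d : ℝ) - α)) • y

/-- Derivative of the integrand. -/
def FF' (d : ℕ) (α : ℝ) (x y : EE d) : EE d →L[ℝ] EE d :=
  (‖y‖ ^ (-(d : ℝ) - α)) • ((drho d α (x + y) - drho d α (x - y)).smulRight y)

lemma meas_k (d : ℕ) (α : ℝ) : Measurable (fun y : EE d => ‖y‖ ^ (-(d : ℝ) - α)) := by fun_prop

lemma FF_meas (d : ℕ) (α : ℝ) (x : EE d) : AEStronglyMeasurable (FF d α x) := by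
  have h := continuous_rho d α
  unfold FF
  have h1 : AEStronglyMeasurable (fun y : EE d => rhoA d α (x + y) - rhoA d α (x - y)) :=
    Continuous.aestronglyMeasurable (by fun_prop)
  exact (h1.mul (meas_k d α).aestronglyMeasurable).smul continuous_id.aestronglyMeasurable

lemma FF'_meas (d : ℕ) (α : ℝ) (hα : 0 < α) (x : EE d) : AEStronglyMeasurable (FF' d α x) := by
  have h := continuous_drho d α hα
  unfold FF'
  have h1 : Continuous (fun y : EE d => drho d α (x + y) - drho d α (x - y)) := by fun_prop
  have h2 : Continuous (fun y : EE d =>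
      (drho d α (x + y) - drho d α (x - y)).smulRight y) := 
    ((ContinuousLinearMap.smulRightL ℝ (EE d) (EE d)).continuous.comp h1).clm_apply continuous_id
  exact (meas_k d α).aestronglyMeasurable.smul h2.aestronglyMeasurable

lemma FF'_cont (d : ℕ) (α : ℝ) (hα : 0 < α) (y : EE d) : Continuous (fun x => FF' d α x y) := by
  have h := continuous_drho d α hα
  unfold FF'
  have h1 : Continuous (fun x : EE d => drho d α (x + y) - drho d α (x - y)) := by fun_prop
  have h2 : Continuous (fun x : EE d =>
      (drho d α (x + y) - drho d α (x - y)).smulRight y) :=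
    ((ContinuousLinearMap.smulRightL ℝ (EE d) (EE d)).continuous.comp h1).clm_apply
      continuous_const
  exact h2.const_smul (‖y‖ ^ (-(d : ℝ) - α))

lemma g_deriv (d : ℕ) (α : ℝ) (x y : EE d) :
    HasFDerivAt (fun x => rhoA d α (x + y) - rhoA d α (x - y))
      (drho d α (x + y) - drho d α (x - y)) x := by
  have h1 : HasFDerivAt (fun x => rhoA d α (x + y)) (drho d α (x + y)) x :=
    (hasFDerivAt_comp_add_right y).2 (hasFDerivAt_rho d α (x + y))
  have h2 : HasFDerivAt (fun x => rhoA d α (x - y)) (drho d α (x - y)) x :=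
    (hasFDerivAt_comp_sub y).2 (hasFDerivAt_rho d α (x - y))
  exact h1.sub h2

lemma FF_deriv (d : ℕ) (α : ℝ) (x y : EE d) :
    HasFDerivAt (fun x => FF d α x y) (FF' d α x y) x := by
  have h := ((g_deriv d α x y).mul_const (‖y‖ ^ (-(d : ℝ) - α))).smul_const y
  unfold FF FF'
  refine h.congr_fderiv ?_
  ext v
  simp
  ring

lemma rho_shift' (d : ℕ) (α : ℝ) (hα : 0 < α) (M : ℝ) (x y : EE d) (hx : ‖x‖ ≤ M) :
    rhoA d α (x - y) ≤ (2 + 2 * M ^ 2) ^ (((d : ℝ) + α) / 2) * rhoA d α y := by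
  have := rho_shift d α hα M x (-y) hx
  rw [← sub_eq_add_neg] at this
  refine this.trans (le_of_eq ?_)
  simp [rhoA]

lemma two_norm {d : ℕ} (x y : EE d) : ‖x + y - (x - y)‖ = 2 * ‖y‖ := by
  rw [show x + y - (x - y) = (2:ℝ) • y by rw [two_smul]; abel, norm_smul]
  simp

/-- dominating constant -/
def MM (d : ℕ) (α M : ℝ) : ℝ := 2 * (2 + 2 * M ^ 2) ^ (((d : ℝ) + α) / 2)

lemma MM_nonneg (d : ℕ) (α M : ℝ) : 0 ≤ MM d α M := by unfold MM; positivity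

lemma FF_bound (d : ℕ) (hd : 1 ≤ d) (α : ℝ) (hα : 0 < α) (M : ℝ) (x y : EE d) (hx : ‖x‖ ≤ M) :
    ‖FF d α x y‖ ≤ (2 * (d + α)) * qq (d + α) 1 ‖y‖ + MM d α M * rhoA d α y := by
  have : ‖FF d α x y‖ = |rhoA d α (x + y) - rhoA d α (x - y)| * (‖y‖ ^ (-(d : ℝ) - α) * ‖y‖) := by
    unfold FF
    rw [norm_smul, Real.norm_eq_abs, abs_mul, abs_of_nonneg (a := ‖y‖ ^ _) (by positivity)]
    ring
  rw [this]
  refine dom d hd α hα y _ _ _ (by positivity) (MM_nonneg d α M) ?_ ?_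
  · have := rho_lip d α hα (x + y) (x - y)
    rw [two_norm] at this
    linarith
  · have h1 := rho_shift d α hα M x y hx
    have h2 := rho_shift' d α hα M x y hx
    have h3 := (rho_pos d α (x + y))
    have h4 := (rho_pos d α (x - y))
    unfold MM
    rw [abs_le]
    constructor <;> linarith

lemma FF'_bound (d : ℕ) (hd : 1 ≤ d) (α : ℝ) (hα : 0 < α) (M : ℝ) (x y : EE d) (hx : ‖x‖ ≤ M) :
    ‖FF' d α x y‖ ≤ (2 * ((d + α) * (d + α + 3))) * qq (d + α) 1 ‖y‖
      + ((d + α) * MM d α M) * rhoA d α y := by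
  have : ‖FF' d α x y‖ = ‖drho d α (x + y) - drho d α (x - y)‖ * (‖y‖ ^ (-(d : ℝ) - α) * ‖y‖) := by
    unfold FF'
    rw [norm_smul, Real.norm_of_nonneg (by positivity), ContinuousLinearMap.norm_smulRight_apply]
    ring
  have hM := MM_nonneg d α M
  rw [this]
  refine dom d hd α hα y _ _ _ (by positivity) (by positivity) ?_ ?_
  · have := drho_lip0 d α hα (x + y) (x - y)
    rw [two_norm] at this
    linarith
  · have h1 := rho_shift d α hα M x y hx
    have h2 := rho_shift' d α hα M x y hx
    have h3 := drho_norm d α hα (x + y)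
    have h4 := drho_norm d α hα (x - y)
    have h5 := norm_sub_le (drho d α (x + y)) (drho d α (x - y))
    have h6 : (0:ℝ) ≤ d + α := by positivity
    have h7 := mul_le_mul_of_nonneg_left h1 h6
    have h8 := mul_le_mul_of_nonneg_left h2 h6
    unfold MM
    linarith

lemma bound_integrable (d : ℕ) (hd : 1 ≤ d) (α : ℝ) (hα : 0 < α) (h2 : α < 2) (C D : ℝ) :
    Integrable (fun y : EE d => C * qq (d + α) 1 ‖y‖ + D * rhoA d α y) :=
  ((qq_integrable d hd α h2 1 one_pos).const_mul C).add ((rho_integrable d α hα).const_mul D)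

lemma FF_integrable (d : ℕ) (hd : 1 ≤ d) (α : ℝ) (hα : 0 < α) (h2 : α < 2) (x : EE d) :
    Integrable (FF d α x) :=
  (bound_integrable d hd α hα h2 _ _).mono' (FF_meas d α x)
    (Filter.Eventually.of_forall fun y => FF_bound d hd α hα ‖x‖ x y le_rfl)

lemma near_bound {d : ℕ} (x₀ x : EE d) (hx : x ∈ Metric.ball x₀ 1) : ‖x‖ ≤ ‖x₀‖ + 1 := by
  have : ‖x - x₀‖ < 1 := by simpa [dist_eq_norm] using hx
  have := norm_le_norm_add_norm_sub' x x₀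
  linarith

lemma int_deriv (d : ℕ) (hd : 1 ≤ d) (α : ℝ) (hα : 0 < α) (h2 : α < 2) (x₀ : EE d) :
    HasFDerivAt (fun x => ∫ y, FF d α x y) (∫ y, FF' d α x₀ y) x₀ := by
  refine hasFDerivAt_integral_of_dominated_of_fderiv_le (Metric.ball_mem_nhds x₀ one_pos)
    (Filter.Eventually.of_forall fun x => FF_meas d α x) (FF_integrable d hd α hα h2 x₀)
    (FF'_meas d α hα x₀)
    (Filter.Eventually.of_forall fun y x hx =>
      FF'_bound d hd α hα (‖x₀‖ + 1) x y (near_bound x₀ x hx))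
    (bound_integrable d hd α hα h2 _ _)
    (Filter.Eventually.of_forall fun y x hx => FF_deriv d α x y)

lemma int_cont (d : ℕ) (hd : 1 ≤ d) (α : ℝ) (hα : 0 < α) (h2 : α < 2) :
    Continuous (fun x : EE d => ∫ y, FF' d α x y) := by
  rw [continuous_iff_continuousAt]
  intro x₀
  refine continuousAt_of_dominated
    (Filter.Eventually.of_forall fun x => FF'_meas d α hα x) ?_
    (bound_integrable d hd α hα h2 (2 * ((d + α) * (d + α + 3))) ((d + α) * MM d α (‖x₀‖ + 1)))
    (Filter.Eventually.of_forall fun y => (FF'_cont d α hα y).continuousAt)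
  filter_upwards [Metric.ball_mem_nhds x₀ one_pos] with x hx
  exact Filter.Eventually.of_forall fun y =>
      FF'_bound d hd α hα (‖x₀‖ + 1) x y (near_bound x₀ x hx)

lemma fieldB_contDiff (d : ℕ) (hd : 1 ≤ d) (α : ℝ) (hα : 0 < α) (h2 : α < 2) :
    ContDiff ℝ 1 (fieldB d α) := by
  have h : ContDiff ℝ 1 (fun x : EE d => ∫ y, FF d α x y) :=
    contDiff_one_iff_hasFDerivAt.2 ⟨_, int_cont d hd α hα h2, int_deriv d hd α hα h2⟩
  exact h.const_smul (cdA d α)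

/-! Estimate -/

/-- truncated kernel -/
def KI (s R : ℝ) {d : ℕ} (y : EE d) : EE d := ((max ‖y‖ R) ^ (-s)) • y

lemma rpow_aux (s a b : ℝ) (hs : 0 ≤ s) (ha : 0 < a) (hab : a ≤ b) :
    (a ^ (-s) - b ^ (-s)) * a ≤ s * a ^ (-s) * (b - a) := by
  have hb : 0 < b := ha.trans_le hab
  have h1 : 1 - s * (b / a - 1) ≤ (b / a) ^ (-s) := by
    rw [Real.rpow_def_of_pos (by positivity)]
    have h2 := Real.add_one_le_exp (Real.log (b / a) * -s)
    have h3 := Real.log_le_sub_one_of_pos (show 0 < b / a by positivity)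
    nlinarith
  have h4 : b ^ (-s) = a ^ (-s) * (b / a) ^ (-s) := by
    rw [← Real.mul_rpow ha.le (by positivity), mul_div_cancel₀ _ ha.ne']
  have h5 : (b / a - 1) * a = b - a := by field_simp
  have h6 : 0 < a ^ (-s) := Real.rpow_pos_of_pos ha _
  rw [h4]
  calc _ = a ^ (-s) * a * (1 - (b / a) ^ (-s)) := by ring
    _ ≤ a ^ (-s) * a * (s * (b / a - 1)) := by gcongr; linarith
    _ = s * a ^ (-s) * ((b / a - 1) * a) := by ring
    _ = _ := by rw [h5]

lemma KI_lip (s R : ℝ) (hs : 0 ≤ s) (hR : 0 < R) {d : ℕ} (y z : EE d) :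
    ‖KI s R y - KI s R z‖ ≤ (1 + s) * R ^ (-s) * ‖y - z‖ := by
  wlog h : ‖y‖ ≤ ‖z‖ generalizing y z
  · rw [norm_sub_rev, norm_sub_rev y]
    exact this z y (not_le.1 h).le
  unfold KI
  set a := max ‖y‖ R with ha
  set b := max ‖z‖ R with hb
  have hRa : R ≤ a := le_max_right _ _
  have hRb : R ≤ b := le_max_right _ _
  have hab : a ≤ b := max_le_max_right R h
  have hya : ‖y‖ ≤ a := le_max_left _ _
  have ha0 : 0 < a := hR.trans_le hRa
  have hb0 : 0 < b := hR.trans_le hRb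
  have hba : b - a ≤ ‖y - z‖ := by
    have := abs_max_sub_max_le_abs ‖z‖ ‖y‖ R
    have h2 := abs_norm_sub_norm_le z y
    rw [norm_sub_rev] at h2
    have h3 := le_abs_self (b - a)
    linarith
  have e : a ^ (-s) • y - b ^ (-s) • z = b ^ (-s) • (y - z) + (a ^ (-s) - b ^ (-s)) • y := by
    rw [smul_sub, sub_smul]; abel
  have hmon : b ^ (-s) ≤ a ^ (-s) := Real.rpow_le_rpow_of_nonpos ha0 hab (by linarith)
  have hbR : b ^ (-s) ≤ R ^ (-s) := Real.rpow_le_rpow_of_nonpos hR hRb (by linarith)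
  have haR : a ^ (-s) ≤ R ^ (-s) := Real.rpow_le_rpow_of_nonpos hR hRa (by linarith)
  rw [e]
  refine (norm_add_le _ _).trans ?_
  rw [norm_smul, norm_smul, Real.norm_of_nonneg (by positivity),
    Real.norm_of_nonneg (by linarith)]
  have h1 : (a ^ (-s) - b ^ (-s)) * ‖y‖ ≤ s * R ^ (-s) * ‖y - z‖ :=
    calc _ ≤ (a ^ (-s) - b ^ (-s)) * a := mul_le_mul_of_nonneg_left hya (by linarith)
      _ ≤ s * a ^ (-s) * (b - a) := rpow_aux s a b hs ha0 hab
      _ ≤ s * R ^ (-s) * ‖y - z‖ := by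
        have : 0 ≤ b - a := by linarith
        gcongr
  have h2 : b ^ (-s) * ‖y - z‖ ≤ R ^ (-s) * ‖y - z‖ := by gcongr
  linarith

lemma KI_bdd (s R : ℝ) (hs : 1 ≤ s) (hR : 0 < R) {d : ℕ} (y : EE d) :
    ‖KI s R y‖ ≤ R ^ (1 - s) := by
  unfold KI
  have hRa : R ≤ max ‖y‖ R := le_max_right _ _
  have ha0 : 0 < max ‖y‖ R := hR.trans_le hRa
  rw [norm_smul, Real.norm_of_nonneg (by positivity)]
  calc _ ≤ (max ‖y‖ R) ^ (-s) * max ‖y‖ R := by gcongr; exact le_max_left _ _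
    _ = (max ‖y‖ R) ^ (1 - s) := by rw [← Real.rpow_add_one ha0.ne']; congr 1; ring
    _ ≤ _ := Real.rpow_le_rpow_of_nonpos hR hRa (by linarith)

lemma KI_cont (s R : ℝ) (hs : 0 ≤ s) (hR : 0 < R) (d : ℕ) : Continuous (KI s R (d := d)) := by
  have : LipschitzWith (Real.toNNReal ((1 + s) * R ^ (-s))) (KI s R (d := d)) := by
    apply LipschitzWith.of_dist_le_mul
    intro a b
    rw [dist_eq_norm, dist_eq_norm, Real.coe_toNNReal _ (by positivity)]
    exact KI_lip s R hs hR a b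
  exact this.continuous

lemma rho_KI_integrable (d : ℕ) (α s R : ℝ) (hs : 1 ≤ s) (hR : 0 < R)
    (f g : EE d → EE d) (hf : Integrable (fun y => rhoA d α (f y))) (hg : Continuous g) :
    Integrable (fun y => rhoA d α (f y) • KI s R (g y)) := by
  have hK := KI_cont s R (by linarith) hR d
  exact hf.smul_bdd (R ^ (1 - s)) (hK.comp hg).aestronglyMeasurable
    (Filter.Eventually.of_forall fun y => KI_bdd s R hs hR (g y))

/-- difference of integrand and truncated integrand -/
def PP (d : ℕ) (α R : ℝ) (x y : EE d) : EE d :=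
  FF d α x y - (rhoA d α (x + y) • KI (d + α) R y - rhoA d α (x - y) • KI (d + α) R y)

/-- constant -/
def C1 (d : ℕ) (α R : ℝ) : ℝ :=
  (d + α) * (d + α + 3) * (1 + R ^ 2) ^ (-(((d : ℝ) + α) / 2 + 1)) * 2

lemma C1_nonneg (d : ℕ) (α R : ℝ) (hα : 0 < α) : 0 ≤ C1 d α R := by unfold C1; positivity

lemma g_lip (d : ℕ) (α R : ℝ) (hα : 0 < α) (hR : 0 < R) (x₀ x x' y : EE d) (h0 : ‖x₀‖ = 3 * R)
    (hx : x ∈ Metric.ball x₀ R) (hx' : x' ∈ Metric.ball x₀ R) (hy : ‖y‖ ≤ R) :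
    |(rhoA d α (x + y) - rhoA d α (x - y)) - (rhoA d α (x' + y) - rhoA d α (x' - y))|
      ≤ C1 d α R * ‖y‖ * ‖x - x'‖ := by
  refine (convex_ball x₀ R).norm_image_sub_le_of_norm_hasFDerivWithin_le
    (f := fun x => rhoA d α (x + y) - rhoA d α (x - y))
    (f' := fun x => drho d α (x + y) - drho d α (x - y))
    (fun z _ => (g_deriv d α z y).hasFDerivWithinAt) (fun z hz => ?_) hx' hx
  have hz' : ‖z - x₀‖ < R := by simpa [dist_eq_norm] using hz
  refine (drho_lip d α hα (Metric.ball x₀ (2 * R)) (convex_ball _ _) R hR.le ?_ _ _ ?_ ?_).trans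
    (le_of_eq ?_)
  · intro w hw
    have hw' : ‖w - x₀‖ < 2 * R := by simpa [dist_eq_norm] using hw
    have := norm_le_norm_add_norm_sub w x₀
    linarith
  · rw [Metric.mem_ball, dist_eq_norm, show z + y - x₀ = (z - x₀) + y by abel]
    have := norm_add_le (z - x₀) y
    linarith
  · rw [Metric.mem_ball, dist_eq_norm, show z - y - x₀ = (z - x₀) - y by abel]
    have := norm_sub_le (z - x₀) y
    linarith
  · rw [two_norm, C1]
    ring

lemma PP_lip (d : ℕ) (α R : ℝ) (hα : 0 < α) (hR : 0 < R) (x₀ x x' y : EE d) (h0 : ‖x₀‖ = 3 * R)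
    (hx : x ∈ Metric.ball x₀ R) (hx' : x' ∈ Metric.ball x₀ R) :
    ‖PP d α R x y - PP d α R x' y‖ ≤ C1 d α R * ‖x - x'‖ * qq (d + α) R ‖y‖ := by
  have hC := C1_nonneg d α R hα
  have hs : (0:ℝ) < d + α := by positivity
  have hqn := qq_nonneg (d + α) R ‖y‖ (norm_nonneg y)
  have e : ∀ x, PP d α R x y = ((rhoA d α (x + y) - rhoA d α (x - y)) *
      (‖y‖ ^ (-((d : ℝ) + α)) - (max ‖y‖ R) ^ (-((d : ℝ) + α)))) • y := by
    intro x
    unfold PP FF KI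
    rw [show -(d : ℝ) - α = -((d : ℝ) + α) by ring]
    module
  rw [e, e, ← sub_smul, ← sub_mul, norm_smul, Real.norm_eq_abs, abs_mul]
  by_cases hy : ‖y‖ ≤ R
  · have hg := g_lip d α R hα hR x₀ x x' y h0 hx hx' hy
    rcases eq_or_ne y 0 with rfl | hy0
    · simp only [norm_zero, mul_zero] at *
      positivity
    have hy' : 0 < ‖y‖ := norm_pos_iff.2 hy0
    rw [max_eq_right hy]
    have h1 : R ^ (-((d : ℝ) + α)) ≤ ‖y‖ ^ (-((d : ℝ) + α)) :=
      Real.rpow_le_rpow_of_nonpos hy' hy (by linarith)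
    have h2 : 0 < R ^ (-((d : ℝ) + α)) := Real.rpow_pos_of_pos hR _
    rw [abs_of_nonneg (a := _ - R ^ _) (by linarith)]
    have hq : qq (d + α) R ‖y‖ = ‖y‖ ^ (-((d : ℝ) + α)) * ‖y‖ * ‖y‖ := by
      unfold qq
      rw [Set.indicator_of_mem (show ‖y‖ ∈ Set.Iic R from hy), ← Real.rpow_add_one hy'.ne',
        ← Real.rpow_add_one hy'.ne']
      congr 1
      ring
    rw [hq]
    calc _ ≤ (C1 d α R * ‖y‖ * ‖x - x'‖) * ‖y‖ ^ (-((d : ℝ) + α)) * ‖y‖ := by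
          gcongr
          linarith
      _ = _ := by ring
  · push Not at hy
    rw [max_eq_left hy.le, sub_self, abs_zero, mul_zero, zero_mul]
    positivity

lemma shift1 (d : ℕ) (α R : ℝ) (x : EE d) :
    ∫ y, rhoA d α (x + y) • KI (d + α) R y = ∫ z, rhoA d α z • KI (d + α) R (z - x) := by
  rw [← integral_add_left_eq_self (fun z => rhoA d α z • KI (d + α) R (z - x)) x]
  simp

lemma shift2 (d : ℕ) (α R : ℝ) (x : EE d) :
    ∫ y, rhoA d α (x - y) • KI (d + α) R y = ∫ z, rhoA d α z • KI (d + α) R (x - z) := by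
  rw [← integral_sub_left_eq_self (fun z => rhoA d α z • KI (d + α) R (x - z)) volume x]
  simp

lemma conv_lip (d : ℕ) (hd : 1 ≤ d) (α R : ℝ) (hα : 0 < α) (hR : 0 < R) (t : ℝ)
    (f g : EE d → EE d) (hf : Continuous f) (hg : Continuous g)
    (hfg : ∀ z, ‖f z - g z‖ ≤ t) :
    ‖(∫ z, rhoA d α z • KI (d + α) R (f z)) - ∫ z, rhoA d α z • KI (d + α) R (g z)‖ ≤
      (1 + (d + α)) * R ^ (-((d : ℝ) + α)) * t * ∫ z, rhoA d α z := by
  have hd' : (1:ℝ) ≤ d := by exact_mod_cast hd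
  have hρ := rho_integrable d α hα
  rw [← integral_sub
    (rho_KI_integrable d α (d + α) R (by linarith) hR (fun z => z) f hρ hf)
    (rho_KI_integrable d α (d + α) R (by linarith) hR (fun z => z) g hρ hg), ← integral_const_mul]
  refine norm_integral_le_of_norm_le (hρ.const_mul _) (Filter.Eventually.of_forall fun z => ?_)
  rw [← smul_sub, norm_smul, Real.norm_of_nonneg (rho_pos d α z).le, mul_comm]
  have h1 := KI_lip (d + α) R (by linarith) hR (f z) (g z)
  have h2 := (rho_pos d α z).le
  have h3 := hfg z
  refine mul_le_mul_of_nonneg_right (h1.trans ?_) h2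
  gcongr

/-- constant -/
def c0 (d : ℕ) (α : ℝ) : ℝ := d * (volume : Measure (EE d)).real (Metric.ball 0 1) / (2 - α)

lemma split_int (d : ℕ) (hd : 1 ≤ d) (α R : ℝ) (hα : 0 < α) (h2 : α < 2) (hR : 0 < R) (x : EE d) :
    Integrable (PP d α R x) ∧
    ∫ y, FF d α x y = (∫ y, PP d α R x y) + ((∫ z, rhoA d α z • KI (d + α) R (z - x)) -
      ∫ z, rhoA d α z • KI (d + α) R (x - z)) := by
  have hd' : (1:ℝ) ≤ d := by exact_mod_cast hd
  have hρ := rho_integrable d α hα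
  have i1 := rho_KI_integrable d α (d + α) R (by linarith) hR (fun y => x + y) id
    (hρ.comp_add_left x) continuous_id
  have i2 := rho_KI_integrable d α (d + α) R (by linarith) hR (fun y => x - y) id
    (hρ.comp_sub_left x) continuous_id
  simp only [id] at i1 i2
  have i3 : Integrable (PP d α R x) := (FF_integrable d hd α hα h2 x).sub (i1.sub i2)
  refine ⟨i3, ?_⟩
  have i4 : Integrable (fun y => rhoA d α (x + y) • KI (d + α) R y
      - rhoA d α (x - y) • KI (d + α) R y) := i1.sub i2
  rw [← shift1, ← shift2, ← integral_sub i1 i2, ← integral_add i3 i4]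
  congr 1
  ext1 y
  unfold PP
  simp

lemma C1_bound (d : ℕ) (α R : ℝ) (hα : 0 < α) (hR : 0 < R) :
    C1 d α R * R ^ (2 - α) ≤ (d + α) * (d + α + 3) * 2 * R ^ (-((d : ℝ) + α)) := by
  have h1 : (1 + R ^ 2) ^ (-(((d : ℝ) + α) / 2 + 1)) ≤ R ^ (-((d : ℝ) + 2)) := by
    calc _ ≤ (1 + R ^ 2) ^ (-(((d : ℝ) + 2) / 2)) := by
          apply Real.rpow_le_rpow_of_exponent_le
          · nlinarith
          · linarith
      _ ≤ (R ^ 2) ^ (-(((d : ℝ) + 2) / 2)) := by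
          apply Real.rpow_le_rpow_of_nonpos (by positivity) (by linarith)
          have : (0:ℝ) ≤ (d + 2) / 2 := by positivity
          linarith
      _ = _ := by
          rw [← Real.rpow_natCast, ← Real.rpow_mul hR.le]
          congr 1
          push_cast
          ring
  have h2 : R ^ (-((d : ℝ) + α)) = R ^ (-((d : ℝ) + 2)) * R ^ (2 - α) := by
    rw [← Real.rpow_add hR]
    congr 1
    ring
  rw [h2, C1]
  calc _ = (d + α) * (d + α + 3) * 2 * ((1 + R ^ 2) ^ (-(((d : ℝ) + α) / 2 + 1)) * R ^ (2 - α)) := by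
        ring
    _ ≤ _ := by gcongr

/-- constant -/
def K2 (d : ℕ) (α : ℝ) : ℝ :=
  (d + α) * (d + α + 3) * 2 * c0 d α + 2 * (1 + (d + α)) * ∫ z, rhoA d α z

lemma K2_nonneg (d : ℕ) (α : ℝ) (hα : 0 < α) (h2 : α < 2) : 0 ≤ K2 d α := by
  have h1 : 0 ≤ ∫ z, rhoA d α z := integral_nonneg fun z => (rho_pos d α z).le
  have h3 : 0 < 2 - α := by linarith
  unfold K2 c0
  positivity

lemma int_lip (d : ℕ) (hd : 1 ≤ d) (α R : ℝ) (hα : 0 < α) (h2 : α < 2) (hR : 0 < R)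
    (x₀ x x' : EE d) (h0 : ‖x₀‖ = 3 * R)
    (hx : x ∈ Metric.ball x₀ R) (hx' : x' ∈ Metric.ball x₀ R) :
    ‖(∫ y, FF d α x y) - ∫ y, FF d α x' y‖ ≤ K2 d α * R ^ (-((d : ℝ) + α)) * ‖x - x'‖ := by
  obtain ⟨i1, e1⟩ := split_int d hd α R hα h2 hR x
  obtain ⟨i2, e2⟩ := split_int d hd α R hα h2 hR x'
  have h3 : 0 < 2 - α := by linarith
  have hc0 : 0 ≤ c0 d α := by unfold c0; positivity
  have b1 : ‖(∫ y, PP d α R x y) - ∫ y, PP d α R x' y‖ ≤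
      (d + α) * (d + α + 3) * 2 * c0 d α * R ^ (-((d : ℝ) + α)) * ‖x - x'‖ := by
    rw [← integral_sub i1 i2]
    refine (norm_integral_le_of_norm_le ((qq_integrable d hd α h2 R hR).const_mul
      (C1 d α R * ‖x - x'‖)) (Filter.Eventually.of_forall fun y =>
        PP_lip d α R hα hR x₀ x x' y h0 hx hx')).trans ?_
    rw [integral_const_mul, qq_integral d hd α h2 R hR, ← c0]
    have := mul_le_mul_of_nonneg_right (C1_bound d α R hα hR)
      (show 0 ≤ c0 d α * ‖x - x'‖ by positivity)
    linarith
  have b2 := conv_lip d hd α R hα hR ‖x - x'‖ (fun z => z - x) (fun z => z - x') (by fun_prop)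
    (by fun_prop) (fun z => by
      rw [show z - x - (z - x') = -(x - x') by abel, norm_neg])
  have b3 := conv_lip d hd α R hα hR ‖x - x'‖ (fun z => x - z) (fun z => x' - z) (by fun_prop)
    (by fun_prop) (fun z => by
      rw [show x - z - (x' - z) = (x - x') by abel])
  rw [e1, e2, add_sub_add_comm, sub_sub_sub_comm]
  refine (norm_add_le _ _).trans ((add_le_add_right (norm_sub_le _ _) _).trans ?_)
  refine (add_le_add b1 (add_le_add b2 b3)).trans (le_of_eq ?_)
  unfold K2
  ring

theorem stmt_12 (d : ℕ) (hd : 1 ≤ d) (α : ℝ) (hα : α ∈ Set.Ioo (0 : ℝ) 2) :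
    ContDiff ℝ 1 (fieldB d α) ∧
    ∃ κ₀ > (0 : ℝ), ∀ x : EuclideanSpace ℝ (Fin d), x ≠ 0 →
      ‖fderiv ℝ (fieldB d α) x‖ ≤ κ₀ * ‖x‖ ^ (-(d : ℝ) - α) := by
  obtain ⟨h1, h2⟩ := hα
  have hK := K2_nonneg d α h1 h2
  refine ⟨fieldB_contDiff d hd α h1 h2,
    |cdA d α| * K2 d α * (1 / 3 : ℝ) ^ (-((d : ℝ) + α)) + 1, by positivity, ?_⟩
  intro x₀ hx₀
  have hn : 0 < ‖x₀‖ := norm_pos_iff.2 hx₀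
  set R := 1 / 3 * ‖x₀‖ with hRdef
  have hR : 0 < R := by positivity
  have hlip : LipschitzOnWith (Real.toNNReal (|cdA d α| * (K2 d α * R ^ (-((d : ℝ) + α)))))
      (fieldB d α) (Metric.ball x₀ R) := by
    apply LipschitzOnWith.of_dist_le_mul
    intro x hx x' hx'
    rw [dist_eq_norm, dist_eq_norm, Real.coe_toNNReal _ (by positivity)]
    have e : fieldB d α x - fieldB d α x' =
        cdA d α • ((∫ y, FF d α x y) - ∫ y, FF d α x' y) := by
      rw [smul_sub]; rfl
    rw [e, norm_smul, Real.norm_eq_abs, mul_assoc]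
    have := int_lip d hd α R h1 h2 hR x₀ x x' (by rw [hRdef]; ring) hx hx'
    gcongr
  have h := norm_fderiv_le_of_lipschitzOn ℝ (Metric.ball_mem_nhds x₀ hR) hlip
  rw [Real.coe_toNNReal _ (by positivity), hRdef, Real.mul_rpow (by norm_num) hn.le] at h
  rw [show -(d : ℝ) - α = -((d : ℝ) + α) by ring]
  have h3 : 0 < ‖x₀‖ ^ (-((d : ℝ) + α)) := Real.rpow_pos_of_pos hn _
  refine h.trans ?_
  nlinarith
end
end
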